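/- Let I be a Cartwright-Sturmfels ideal of S and let J be a radical Borel fixed ideal of S with the same Z^v-graded Hilbert series as I. Then for every term order τ on S (with x_{ij} > x_{ik} for j < k) one has gin_τ(I) = J. In particular, I is a radical ideal and is generated by Z^v-homogeneous elements of multidegree componentwise at most e_1+...+e_v = (1,...,1) ∈ Z^v. -/

import Mathlib

open MvPolynomial

noncomputable section

namespace CSPaper

/-- The set of variables of the standard `ℤ^v`-graded polynomial ring `S`:
the variable `x_{i j}` of the paper (with `1 ≤ i ≤ v`, `1 ≤ j ≤ n_i`) corresponds to
`⟨i-1, j-1⟩ : MVar v n` where `n (i-1) = n_i - 1`; thus row `i` has `n i + 1 > 0`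
variables and the first variable `x_{i 1}` of row `i` corresponds to `⟨i, 0⟩`. -/
abbrev MVar (v : ℕ) (n : Fin v → ℕ) : Type := Σ i : Fin v, Fin (n i + 1)

/-- The weight function giving the standard `ℤ^v`-grading: `deg (x_{i j}) = e_i ∈ ℤ^v`. -/
def wt (v : ℕ) (n : Fin v → ℕ) : MVar v n → (Fin v → ℕ) := fun p => Pi.single p.1 1

variable {K : Type} [Field K] {v : ℕ} {n : Fin v → ℕ}

/-- An ideal of `S` is `ℤ^v`-graded (multigraded) iff it contains every multihomogeneous
component of each of its elements. -/
def IsMultigraded (I : Ideal (MvPolynomial (MVar v n) K)) : Prop :=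
  ∀ f ∈ I, ∀ a : Fin v → ℕ, weightedHomogeneousComponent (wt v n) a f ∈ I

/-- The value of the `ℤ^v`-graded Hilbert function of the ideal `I` at `a ∈ ℕ^v`:
`dim_K I_a`. -/
def hilb (I : Ideal (MvPolynomial (MVar v n) K)) (a : Fin v → ℕ) : ℕ :=
  Module.finrank K
    ((Submodule.restrictScalars K I ⊓ weightedHomogeneousSubmodule K (wt v n) a :
      Submodule K (MvPolynomial (MVar v n) K)))

/-- Two ideals have the same `ℤ^v`-graded Hilbert series. -/
def sameHS (I J : Ideal (MvPolynomial (MVar v n) K)) : Prop :=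
  ∀ a : Fin v → ℕ, hilb I a = hilb J a

/-- The `ℤ^v`-graded `K`-algebra endomorphism of `S` determined by a `v`-tuple of square
matrices: `x_{i j} ↦ ∑_k (g i)_{k j} x_{i k}`.  For invertible `g i` these are exactly the
elements of `G = GL_{n_1}(K) × ⋯ × GL_{n_v}(K)` acting on `S`. -/
def gAct (g : ∀ i : Fin v, Matrix (Fin (n i + 1)) (Fin (n i + 1)) K) :
    MvPolynomial (MVar v n) K →ₐ[K] MvPolynomial (MVar v n) K :=
  aeval fun p : MVar v n => ∑ k : Fin (n p.1 + 1), C (g p.1 k p.2) * X ⟨p.1, k⟩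

/-- A property `P` of `v`-tuples of matrices holds generically (i.e. for a general
`g ∈ GL_{n_1}(K) × ⋯ × GL_{n_v}(K)`) if there is a nonzero polynomial `h` in the matrix
entries such that `P g` holds for every invertible `g` with `h(g) ≠ 0`. -/
def Generically
    (P : (∀ i : Fin v, Matrix (Fin (n i + 1)) (Fin (n i + 1)) K) → Prop) : Prop :=
  ∃ h : MvPolynomial (Σ i : Fin v, Fin (n i + 1) × Fin (n i + 1)) K, h ≠ 0 ∧
    ∀ g : ∀ i : Fin v, Matrix (Fin (n i + 1)) (Fin (n i + 1)) K,
      (∀ i, IsUnit (g i).det) →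
      eval (fun q : Σ i : Fin v, Fin (n i + 1) × Fin (n i + 1) => g q.1 q.2.1 q.2.2) h ≠ 0 →
      P g

/-- The leading exponent (exponent of the leading monomial) of a polynomial with respect to
a term order `τ` (a `MonomialOrder`); by convention `leadExp τ 0 = 0`. -/
def leadExp (τ : MonomialOrder (MVar v n)) (f : MvPolynomial (MVar v n) K) :
    MVar v n →₀ ℕ :=
  τ.toSyn.symm (f.support.sup τ.toSyn)

/-- The initial ideal `in_τ(I)`: the monomial ideal generated by the leading monomials of the
nonzero elements of `I`. -/
def inIdeal (τ : MonomialOrder (MVar v n)) (I : Ideal (MvPolynomial (MVar v n) K)) :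
    Ideal (MvPolynomial (MVar v n) K) :=
  Ideal.span {m | ∃ f ∈ I, f ≠ 0 ∧ m = monomial (leadExp τ f) (1 : K)}

/-- `G` is a Gröbner basis of `I` with respect to the term order `τ`. -/
def IsGroebnerBasis (τ : MonomialOrder (MVar v n)) (G : Set (MvPolynomial (MVar v n) K))
    (I : Ideal (MvPolynomial (MVar v n) K)) : Prop :=
  G ⊆ (I : Set (MvPolynomial (MVar v n) K)) ∧
    Ideal.span ((fun f => monomial (leadExp τ f) (1 : K)) '' {f ∈ G | f ≠ 0}) = inIdeal τ I

/-- `J = gin_τ(I)`, the `ℤ^v`-graded generic initial ideal: for a general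
`g ∈ GL_{n_1}(K) × ⋯ × GL_{n_v}(K)` one has `in_τ(g(I)) = J`. -/
def IsGin (τ : MonomialOrder (MVar v n)) (I J : Ideal (MvPolynomial (MVar v n) K)) : Prop :=
  Generically fun g => inIdeal τ (Ideal.map (gAct g) I) = J

/-- A term order such that `x_{i j} > x_{i k}` whenever `j < k`. -/
def RespectsVarOrder (τ : MonomialOrder (MVar v n)) : Prop :=
  ∀ (i : Fin v) (j k : Fin (n i + 1)), j < k →
    τ.toSyn (Finsupp.single (⟨i, k⟩ : MVar v n) 1) <
      τ.toSyn (Finsupp.single (⟨i, j⟩ : MVar v n) 1)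

/-- An ideal is Borel fixed if it is fixed by every element of the Borel subgroup
`B = B_{n_1}(K) × ⋯ × B_{n_v}(K)` of upper triangular invertible matrices (upper triangular
with respect to the order `x_{i 1} > x_{i 2} > ⋯` of the variables in each row). -/
def BorelFixed (I : Ideal (MvPolynomial (MVar v n) K)) : Prop :=
  ∀ g : ∀ i : Fin v, Matrix (Fin (n i + 1)) (Fin (n i + 1)) K,
    (∀ i, IsUnit (g i).det) →
    (∀ (i : Fin v) (k j : Fin (n i + 1)), j < k → g i k j = 0) →
    Ideal.map (gAct g) I = I

/-- A Cartwright-Sturmfels ideal: a `ℤ^v`-graded ideal with the same `ℤ^v`-graded Hilbert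
series as some radical Borel fixed ideal. -/
def IsCS (I : Ideal (MvPolynomial (MVar v n) K)) : Prop :=
  IsMultigraded I ∧ ∃ J : Ideal (MvPolynomial (MVar v n) K),
    J.IsRadical ∧ BorelFixed J ∧ sameHS I J

/-- The exponent of the monomial `x_{1 1}^{a 1} ⋯ x_{v 1}^{a v}` of
`T = K[x_{1 1}, …, x_{v 1}] ⊆ S`. -/
def Tmono (v : ℕ) (n : Fin v → ℕ) (a : Fin v → ℕ) : MVar v n →₀ ℕ :=
  ∑ i : Fin v, Finsupp.single (⟨i, 0⟩ : MVar v n) (a i)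

/-- A `ℤ^v`-graded ideal of `S` extended from `T`, i.e. generated by monomials in the
variables `x_{1 1}, …, x_{v 1}`. -/
def ExtendedFromT (J : Ideal (MvPolynomial (MVar v n) K)) : Prop :=
  ∃ A : Set (Fin v → ℕ),
    J = Ideal.span ((fun a => monomial (Tmono v n a) (1 : K)) '' A)

/-- A Cartwright-Sturmfels* ideal: a `ℤ^v`-graded ideal with the same `ℤ^v`-graded Hilbert
series as some ideal extended from `T`. -/
def IsCSstar (J : Ideal (MvPolynomial (MVar v n) K)) : Prop :=
  IsMultigraded J ∧ ∃ C : Ideal (MvPolynomial (MVar v n) K), ExtendedFromT C ∧ sameHS J C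

/-- A monomial ideal. -/
def IsMonomialIdeal (I : Ideal (MvPolynomial (MVar v n) K)) : Prop :=
  ∃ A : Set (MVar v n →₀ ℕ), I = Ideal.span ((fun s => monomial s (1 : K)) '' A)

/-- A squarefree monomial ideal. -/
def IsSqfreeMonomialIdeal (I : Ideal (MvPolynomial (MVar v n) K)) : Prop :=
  ∃ A : Set (MVar v n →₀ ℕ), (∀ s ∈ A, ∀ x, s x ≤ 1) ∧
    I = Ideal.span ((fun s => monomial s (1 : K)) '' A)

/-- `J` is the Alexander dual of the squarefree monomial ideal `I`: `J` is generated by the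
products `∏_{x ∈ P} x` as `P` ranges over the minimal primes of `I`. -/
def IsAlexanderDual (I J : Ideal (MvPolynomial (MVar v n) K)) : Prop :=
  J = Ideal.span {m | ∃ F : Finset (MVar v n),
    Ideal.span ((fun x => (X x : MvPolynomial (MVar v n) K)) '' ↑F) ∈ I.minimalPrimes ∧
    m = ∏ x ∈ F, X x}

/-- The sequence `x_{i j} - λ_{i j} x_{i 1}`, `1 ≤ i ≤ v`, `2 ≤ j ≤ n_i`, as a list. -/
def LamList (lam : MVar v n → K) : List (MvPolynomial (MVar v n) K) :=
  (List.finRange v).flatMap fun i =>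
    ((List.finRange (n i + 1)).drop 1).map fun j =>
      X (⟨i, j⟩ : MVar v n) - C (lam ⟨i, j⟩) * X (⟨i, 0⟩ : MVar v n)

/-- A property of the scalars `λ = (λ_{i j})` holds for general `λ ∈ K^N` if there is a
nonzero polynomial `h` in the `λ_{i j}` such that the property holds whenever `h(λ) ≠ 0`. -/
def GenericallyLam {v : ℕ} {n : Fin v → ℕ} (K : Type) [Field K]
    (P : (MVar v n → K) → Prop) : Prop :=
  ∃ h : MvPolynomial (MVar v n) K, h ≠ 0 ∧
    ∀ lam : MVar v n → K, eval lam h ≠ 0 → P lam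

variable {K : Type} [Field K] {v : ℕ} {n : Fin v → ℕ}

/-- A graded free resolution of an ideal `I` of a polynomial ring graded by an additive
monoid `M` via a weight function `w` on the variables:
`⋯ → F_2 → F_1 → F_0 → I → 0`, where `F_p` is the free module with (finite) basis `ι p`,
the basis element `i : ι p` having degree `deg p i ∈ M`, all maps are graded of degree `0`,
and the complex is exact. -/
structure GradedFreeResolution (σ : Type) (K : Type) [Field K] (M : Type) [AddCommMonoid M]
    (w : σ → M) (I : Ideal (MvPolynomial σ K)) where
  ι : ℕ → Type
  finite : ∀ p, Finite (ι p)
  deg : ∀ p, ι p → M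
  aug : (ι 0 →₀ MvPolynomial σ K) →ₗ[MvPolynomial σ K] MvPolynomial σ K
  d : ∀ p, (ι (p + 1) →₀ MvPolynomial σ K) →ₗ[MvPolynomial σ K] (ι p →₀ MvPolynomial σ K)
  aug_graded : ∀ i : ι 0, (aug (Finsupp.single i 1)).IsWeightedHomogeneous w (deg 0 i)
  d_graded : ∀ (p : ℕ) (i : ι (p + 1)) (j : ι p),
    (d p (Finsupp.single i 1)) j = 0 ∨
      ∃ b, ((d p (Finsupp.single i 1)) j).IsWeightedHomogeneous w b ∧
        b + deg p j = deg (p + 1) i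
  range_aug : LinearMap.range aug = (I : Submodule (MvPolynomial σ K) (MvPolynomial σ K))
  exact_zero : LinearMap.ker aug = LinearMap.range (d 0)
  exact : ∀ p, LinearMap.ker (d p) = LinearMap.range (d (p + 1))

/-- A graded free resolution is minimal if all entries of the matrices of the differentials
between free modules lie in the irrelevant maximal ideal, i.e. have zero constant term. -/
def GradedFreeResolution.Minimal {σ M : Type} [AddCommMonoid M] {w : σ → M}
    {I : Ideal (MvPolynomial σ K)} (F : GradedFreeResolution σ K M w I) : Prop :=
  ∀ (p : ℕ) (i : F.ι (p + 1)) (j : F.ι p),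
    MvPolynomial.constantCoeff ((F.d p (Finsupp.single i 1)) j) = 0

/-- The graded Betti number `β_{p,a}` read off from a (minimal) graded free resolution:
the number of basis elements of `F_p` of degree `a`. -/
def GradedFreeResolution.betti {σ M : Type} [AddCommMonoid M] {w : σ → M}
    {I : Ideal (MvPolynomial σ K)} (F : GradedFreeResolution σ K M w I) (p : ℕ) (a : M) :
    ℕ :=
  Nat.card {i : F.ι p // F.deg p i = a}

/-- The set of `t × t` minors of the matrix `A`. -/
def minorsSet {R : Type} [CommRing R] (t : ℕ) {m N : ℕ} (A : Matrix (Fin m) (Fin N) R) :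
    Set R :=
  {d | ∃ (r : Fin t → Fin m) (c : Fin t → Fin N),
    Function.Injective r ∧ Function.Injective c ∧ d = (A.submatrix r c).det}

/-- `I_t(A)`, the ideal generated by the `t × t` minors of `A`. -/
def minorsIdeal {R : Type} [CommRing R] (t : ℕ) {m N : ℕ}
    (A : Matrix (Fin m) (Fin N) R) : Ideal R :=
  Ideal.span (minorsSet t A)

/-- `A` is column-graded: `N ≤ v` and each entry of the `j`-th column is either `0` or
multihomogeneous of degree `e_j ∈ ℤ^v`. -/
def ColumnGraded {m N : ℕ} (A : Matrix (Fin m) (Fin N) (MvPolynomial (MVar v n) K)) :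
    Prop :=
  ∃ h : N ≤ v, ∀ i j, A i j = 0 ∨
    (A i j).IsWeightedHomogeneous (wt v n) (Pi.single (Fin.castLE h j) 1)

/-- `A` is row-graded: `m ≤ v` and each entry of the `i`-th row is either `0` or
multihomogeneous of degree `e_i ∈ ℤ^v`. -/
def RowGraded {m N : ℕ} (A : Matrix (Fin m) (Fin N) (MvPolynomial (MVar v n) K)) : Prop :=
  ∃ h : m ≤ v, ∀ i j, A i j = 0 ∨
    (A i j).IsWeightedHomogeneous (wt v n) (Pi.single (Fin.castLE h i) 1)

/-- The exponent of the polarization of the monomial `x_{1 1}^{a 1} ⋯ x_{v 1}^{a v}` of `T`: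
the squarefree monomial `∏_i x_{i 1} x_{i 2} ⋯ x_{i (a i)}`. -/
def polExp (v : ℕ) (n : Fin v → ℕ) (a : Fin v → ℕ) : MVar v n →₀ ℕ :=
  ∑ i : Fin v, ∑ j ∈ Finset.univ.filter (fun j : Fin (n i + 1) => (j : ℕ) < a i),
    Finsupp.single (⟨i, j⟩ : MVar v n) 1

/-- `P = pol(C)`, the polarization of an ideal `C` extended from `T`
(the exponents of the generators of `C` must fit inside `S`). -/
def IsPolarizationOfT (C P : Ideal (MvPolynomial (MVar v n) K)) : Prop :=
  ∃ A : Set (Fin v → ℕ), (∀ a ∈ A, ∀ i, a i ≤ n i + 1) ∧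
    C = Ideal.span ((fun a => monomial (Tmono v n a) (1 : K)) '' A) ∧
    P = Ideal.span ((fun a => monomial (polExp v n a) (1 : K)) '' A)

/-- `ψ` is an identification of the quotient of `S` by the `ℤ^v`-graded ideal `Q` with a
standard `ℤ^v`-graded polynomial ring, compatible with the gradings. -/
def IsGradedStructureIso {n₂ : Fin v → ℕ} (Q : Ideal (MvPolynomial (MVar v n) K))
    (ψ : (MvPolynomial (MVar v n) K ⧸ Q) ≃ₐ[K] MvPolynomial (MVar v n₂) K) : Prop :=
  ∀ (f : MvPolynomial (MVar v n) K) (a : Fin v → ℕ),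
    f.IsWeightedHomogeneous (wt v n) a →
      (ψ (Ideal.Quotient.mk Q f)).IsWeightedHomogeneous (wt v n₂) a

end CSPaper

open CSPaper

namespace CSPaper

section LeadingExponents

variable {σ K : Type*} [Field K] (τ : MonomialOrder σ)

/-- The set of leading exponents of the nonzero elements of a subspace. -/
def leadSet (W : Submodule K (MvPolynomial σ K)) : Set (σ →₀ ℕ) :=
  {m | ∃ f ∈ W, f ≠ 0 ∧ τ.degree f = m}

theorem leadSet_mono {P Q : Submodule K (MvPolynomial σ K)} (h : P ≤ Q) :
    leadSet τ P ⊆ leadSet τ Q := fun _ ⟨f, hf, hf0, hd⟩ => ⟨f, h hf, hf0, hd⟩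

/-- Reduction: if every leading exponent of `Q` occurs in `P ≤ Q`, then `Q ≤ P`. -/
theorem le_of_leadSet_subset {P Q : Submodule K (MvPolynomial σ K)} (hPQ : P ≤ Q)
    (h : leadSet τ Q ⊆ leadSet τ P) : Q ≤ P := by
  have key : ∀ s : τ.syn, ∀ f ∈ Q, τ.toSyn (τ.degree f) = s → f ∈ P := by
    intro s
    induction s using WellFoundedLT.induction with
    | ind s ih =>
      intro f hf hs
      by_cases hf0 : f = 0
      · simp [hf0]
      obtain ⟨p, hp, hp0, hdeg⟩ := h ⟨f, hf, hf0, rfl⟩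
      set c : K := τ.leadingCoeff f / τ.leadingCoeff p with hc
      have hlp : τ.leadingCoeff p ≠ 0 := τ.leadingCoeff_ne_zero_iff.2 hp0
      have hr : f - c • p ∈ P := by
        by_cases hr0 : f - c • p = 0
        · simp [hr0]
        refine ih _ ?_ (f - c • p) (Q.sub_mem hf (Q.smul_mem _ (hPQ hp))) rfl
        rw [← hs]
        refine lt_of_le_of_ne ?_ ?_
        · refine τ.degree_sub_le.trans (sup_le le_rfl ?_)
          exact τ.degree_smul_le.trans (by rw [hdeg])
        · intro he
          have he' := τ.toSyn.injective he
          apply τ.coeff_degree_ne_zero_iff.2 hr0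
          rw [he', coeff_sub, coeff_smul, smul_eq_mul, ← hdeg]
          change coeff (τ.degree p) f - c * τ.leadingCoeff p = 0
          rw [hc, div_mul_cancel₀ _ hlp, hdeg]
          exact sub_self _
      have := P.add_mem hr (P.smul_mem c hp)
      simpa using this
  exact fun f hf => key _ f hf rfl

/-- Nonzero polynomials with distinct leading exponents are linearly independent. -/
theorem linearIndependent_of_degree_injective {ι : Type*} (f : ι → MvPolynomial σ K)
    (h0 : ∀ i, f i ≠ 0) (hinj : Function.Injective fun i => τ.degree (f i)) :
    LinearIndependent K f := by
  classical
  rw [linearIndependent_iff']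
  intro s c hsum i hi
  by_contra hci
  obtain ⟨j, hj, hmax⟩ := Finset.exists_max_image (s.filter fun i => c i ≠ 0)
    (fun i => τ.toSyn (τ.degree (f i))) ⟨i, by simp [hi, hci]⟩
  rw [Finset.mem_filter] at hj
  have h1 : coeff (τ.degree (f j)) (∑ i ∈ s, c i • f i) = c j * τ.leadingCoeff (f j) := by
    rw [coeff_sum, Finset.sum_eq_single j]
    · simp [MonomialOrder.leadingCoeff]
    · intro k hk hkj
      by_cases hck : c k = 0
      · simp [hck]
      · rw [coeff_smul, τ.coeff_eq_zero_of_lt, smul_zero]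
        refine lt_of_le_of_ne (hmax k (by simp [hk, hck])) ?_
        exact fun he => hkj (hinj (τ.toSyn.injective he))
    · exact fun h => (h hj.1).elim
  rw [hsum, coeff_zero] at h1
  exact mul_ne_zero hj.2 (τ.leadingCoeff_ne_zero_iff.2 (h0 j)) h1.symm

/-- A subspace has a basis indexed by its leading exponents. -/
theorem exists_basis_leadSet (W : Submodule K (MvPolynomial σ K)) :
    ∃ b : Module.Basis (leadSet τ W) K W, ∀ m, (b m : MvPolynomial σ K) ≠ 0 ∧
      τ.degree (b m : MvPolynomial σ K) = m := by
  choose f hfW hf0 hfd using fun m : leadSet τ W => m.2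
  have hli : LinearIndependent K f := linearIndependent_of_degree_injective τ f hf0 (by
    intro m m' h
    simp only [hfd] at h
    exact Subtype.ext h)
  have hspan : Submodule.span K (Set.range f) = W := by
    have hle : Submodule.span K (Set.range f) ≤ W :=
      Submodule.span_le.2 (by rintro _ ⟨m, rfl⟩; exact hfW m)
    refine le_antisymm hle (le_of_leadSet_subset τ hle ?_)
    intro m hm
    exact ⟨f ⟨m, hm⟩, Submodule.subset_span ⟨_, rfl⟩, hf0 _, hfd _⟩
  refine ⟨(Module.Basis.span hli).map (LinearEquiv.ofEq _ _ hspan), fun m => ?_⟩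
  have : (((Module.Basis.span hli).map (LinearEquiv.ofEq _ _ hspan)) m : MvPolynomial σ K)
      = f m := by
    simp [Module.Basis.span_apply]
  rw [this]
  exact ⟨hf0 m, hfd m⟩

theorem finrank_eq_ncard_leadSet (W : Submodule K (MvPolynomial σ K)) :
    Module.finrank K W = (leadSet τ W).ncard := by
  obtain ⟨b, -⟩ := exists_basis_leadSet τ W
  rw [Module.finrank_eq_nat_card_basis b, Nat.card_coe_set_eq]

/-- The coefficients of a polynomial at finitely many exponents. -/
def coeffsAt (B : Finset (σ →₀ ℕ)) : MvPolynomial σ K →ₗ[K] (B → K) :=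
  LinearMap.pi fun u => lcoeff K (u : σ →₀ ℕ)

/-- If a subspace contains `k` elements which are linearly independent after truncation to
exponents in `B`, all bigger than `m`, then it has at least `k` leading exponents above `m`. -/
theorem card_le_ncard_leadSet {ι : Type*} [Fintype ι] (W : Submodule K (MvPolynomial σ K))
    (hfin : (leadSet τ W).Finite) (m : σ →₀ ℕ) (B : Finset (σ →₀ ℕ))
    (hB : ∀ u ∈ B, τ.toSyn m < τ.toSyn u) (f : ι → MvPolynomial σ K) (hf : ∀ i, f i ∈ W)
    (hli : LinearIndependent K fun i => coeffsAt (K := K) B (f i)) :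
    Fintype.card ι ≤ {u ∈ leadSet τ W | τ.toSyn m < τ.toSyn u}.ncard := by
  obtain ⟨b, hb⟩ := exists_basis_leadSet τ W
  set T := {u ∈ leadSet τ W | τ.toSyn m < τ.toSyn u} with hT
  have hTfin : T.Finite := hfin.subset (Set.sep_subset _ _)
  set g : T → (B → K) := fun u => coeffsAt B (b ⟨u, u.2.1⟩ : MvPolynomial σ K) with hg
  have hmem : ∀ p ∈ W, coeffsAt B p ∈ Submodule.span K (Set.range g) := by
    intro p hp
    have hle : (⊤ : Submodule K W) ≤
        (Submodule.span K (Set.range g)).comap ((coeffsAt (K := K) B).comp W.subtype) := by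
      rw [← b.span_eq, Submodule.span_le]
      rintro _ ⟨u, rfl⟩
      by_cases hu : τ.toSyn m < τ.toSyn (u : σ →₀ ℕ)
      · exact Submodule.subset_span ⟨⟨u, u.2, hu⟩, rfl⟩
      · have : coeffsAt B (b u : MvPolynomial σ K) = 0 := by
          ext c
          refine τ.coeff_eq_zero_of_lt ?_
          rw [(hb u).2]
          exact (not_lt.1 hu).trans_lt (hB c c.2)
        simp [this]
    exact hle (Submodule.mem_top (x := (⟨p, hp⟩ : W)))
  have := hTfin.fintype
  calc Fintype.card ι = Module.finrank K (Submodule.span K (Set.range fun i =>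
        coeffsAt (K := K) B (f i))) := (finrank_span_eq_card hli).symm
    _ ≤ Module.finrank K (Submodule.span K (Set.range g)) :=
        Submodule.finrank_mono (Submodule.span_le.2 (by
          rintro _ ⟨i, rfl⟩; exact hmem _ (hf i)))
    _ ≤ Fintype.card T := finrank_range_le_card g
    _ = T.ncard := by rw [← Nat.card_eq_fintype_card, Nat.card_coe_set_eq]

end LeadingExponents

section GenericIndependence

/-- A scalar matrix, regarded as a matrix of constant polynomials. -/
def constMatrix (θ : Type*) {K B ι : Type*} [Field K] (Q : Matrix B ι K) :
    Matrix B ι (MvPolynomial θ K) := Matrix.map Q C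

theorem constMatrix_map_eval {θ K B ι : Type*} [Field K] (Q : Matrix B ι K) (x : θ → K) :
    (constMatrix θ Q).map (eval x) = Q := by
  ext; simp [constMatrix]

variable {θ K ι B : Type*} [Field K] [Fintype ι] [DecidableEq ι] [Fintype B]

theorem exists_right_inverse_of_linearIndependent (A : Matrix ι B K)
    (h : LinearIndependent K A.row) : ∃ Q : Matrix B ι K, A * Q = 1 := by
  classical
  rw [← Matrix.vecMul_injective_iff] at h
  obtain ⟨g, hg⟩ := LinearMap.exists_leftInverse_of_injective A.vecMulLinear
    (LinearMap.ker_eq_bot.2 h)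
  refine ⟨LinearMap.toMatrixRight' g, ?_⟩
  have h1 := congrArg LinearMap.toMatrixRight' hg
  rw [LinearMap.toMatrixRight'_comp, LinearMap.toMatrixRight'_id] at h1
  have h2 : LinearMap.toMatrixRight' A.vecMulLinear = A :=
    LinearMap.toMatrixRight'.apply_symm_apply A
  rwa [h2] at h1

theorem linearIndependent_row_of_det_mul_ne_zero (A : Matrix ι B K) (Q : Matrix B ι K)
    (h : (A * Q).det ≠ 0) : LinearIndependent K A.row := by
  rw [← Matrix.vecMul_injective_iff]
  have h1 : Function.Injective (A * Q).vecMul :=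
    Matrix.vecMul_injective_iff_isUnit.2 ((Matrix.isUnit_iff_isUnit_det _).2 h.isUnit)
  intro x y hxy
  apply h1
  change Matrix.vecMul x A = Matrix.vecMul y A at hxy
  change Matrix.vecMul x (A * Q) = Matrix.vecMul y (A * Q)
  rw [← Matrix.vecMul_vecMul, ← Matrix.vecMul_vecMul, hxy]

/-- Linear independence of the rows of a matrix of polynomials is an open condition. -/
theorem exists_polynomial_linearIndependent (A : Matrix ι B (MvPolynomial θ K)) (x₀ : θ → K)
    (h : LinearIndependent K (A.map (eval x₀)).row) :
    ∃ p : MvPolynomial θ K, p ≠ 0 ∧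
      ∀ x, eval x p ≠ 0 → LinearIndependent K (A.map (eval x)).row := by
  obtain ⟨Q, hQ⟩ := exists_right_inverse_of_linearIndependent _ h
  have hev : ∀ x, eval x (A * constMatrix θ Q).det = (A.map (eval x) * Q).det := by
    intro x
    rw [RingHom.map_det, RingHom.mapMatrix_apply, Matrix.map_mul, constMatrix_map_eval]
  refine ⟨(A * constMatrix θ Q).det, ?_, fun x hx => ?_⟩
  · intro h0
    have := hev x₀
    rw [h0, hQ] at this
    simp at this
  · rw [hev] at hx
    exact linearIndependent_row_of_det_mul_ne_zero _ _ hx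

theorem degree_prod_le_sum (τ : MonomialOrder θ) {α : Type*} (s : Finset α)
    (P : α → MvPolynomial θ K) (d : α → θ →₀ ℕ)
    (h : ∀ i ∈ s, τ.toSyn (τ.degree (P i)) ≤ τ.toSyn (d i)) :
    τ.toSyn (τ.degree (∏ i ∈ s, P i)) ≤ τ.toSyn (∑ i ∈ s, d i) ∧
      coeff (∑ i ∈ s, d i) (∏ i ∈ s, P i) = ∏ i ∈ s, coeff (d i) (P i) := by
  classical
  induction s using Finset.induction_on with
  | empty => simp
  | insert a s ha ih =>
    have ih' := ih fun i hi => h i (Finset.mem_insert_of_mem hi)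
    have h1 := h a (Finset.mem_insert_self _ _)
    rw [Finset.sum_insert ha, Finset.prod_insert ha, Finset.prod_insert ha]
    refine ⟨τ.degree_mul_le.trans ?_, ?_⟩
    · rw [map_add, map_add]
      exact add_le_add h1 ih'.1
    · rw [τ.coeff_mul_of_add_of_degree_le h1 ih'.1, ih'.2]

/-- If the matrix of coefficients of `A` at row-wise maximal exponents has independent rows,
then so does some specialization of `A`. -/
theorem exists_eval_linearIndependent [Infinite K] (τ : MonomialOrder θ)
    (A : Matrix ι B (MvPolynomial θ K)) (d : ι → θ →₀ ℕ)
    (hd : ∀ i b, τ.toSyn (τ.degree (A i b)) ≤ τ.toSyn (d i))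
    (h : LinearIndependent K (Matrix.of fun i b => coeff (d i) (A i b)).row) :
    ∃ x : θ → K, LinearIndependent K (A.map (eval x)).row := by
  obtain ⟨Q, hQ⟩ := exists_right_inverse_of_linearIndependent _ h
  set N : Matrix ι ι (MvPolynomial θ K) := A * constMatrix θ Q with hN
  have hNd : ∀ i j, τ.toSyn (τ.degree (N i j)) ≤ τ.toSyn (d i) := by
    intro i j
    rw [hN, Matrix.mul_apply]
    refine τ.degree_sum_le.trans (Finset.sup_le fun b _ => ?_)
    rw [mul_comm, constMatrix, Matrix.map_apply, ← smul_eq_C_mul]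
    exact τ.degree_smul_le.trans (hd i b)
  have hNc : (Matrix.of fun i j => coeff (d i) (N i j)) = 1 := by
    rw [← hQ]
    ext i j
    rw [Matrix.of_apply, hN, Matrix.mul_apply, Matrix.mul_apply, coeff_sum]
    refine Finset.sum_congr rfl fun b _ => ?_
    rw [constMatrix, Matrix.map_apply, mul_comm, coeff_C_mul, mul_comm, Matrix.of_apply]
  have hdet : N.det ≠ 0 := by
    intro h0
    have h1 : coeff (∑ i, d i) N.det = 1 := by
      rw [← Matrix.det_transpose, Matrix.det_apply', coeff_sum, ← Matrix.det_one (n := ι) (R := K),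
        ← hNc, ← Matrix.det_transpose, Matrix.det_apply']
      refine Finset.sum_congr rfl fun s _ => ?_
      have := (degree_prod_le_sum τ Finset.univ (fun i => N i (s i)) d
        (fun i _ => hNd i (s i))).2
      rw [← map_intCast (C : K →+* MvPolynomial θ K), coeff_C_mul]
      simp [Matrix.transpose_apply, this]
    rw [h0] at h1
    simp at h1
  obtain ⟨x, hx⟩ : ∃ x, eval x N.det ≠ 0 := by
    by_contra! hall
    exact hdet (MvPolynomial.funext fun x => by simp [hall x])
  refine ⟨x, linearIndependent_row_of_det_mul_ne_zero _ Q ?_⟩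
  convert hx using 1
  rw [RingHom.map_det, RingHom.mapMatrix_apply, hN, Matrix.map_mul, constMatrix_map_eval]

end GenericIndependence

section Action

variable {K : Type} [Field K] {v : ℕ} {n : Fin v → ℕ}

/-- The `v`-tuples of square matrices acting on `S`. -/
abbrev Mats (K : Type) (v : ℕ) (n : Fin v → ℕ) : Type :=
  ∀ i : Fin v, Matrix (Fin (n i + 1)) (Fin (n i + 1)) K

theorem gAct_X (g : Mats K v n) (p : MVar v n) :
    gAct g (X p) = ∑ k : Fin (n p.1 + 1), C (g p.1 k p.2) * X ⟨p.1, k⟩ := by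
  simp [gAct]

theorem gAct_mul (g h : Mats K v n) : gAct (g * h) = (gAct g).comp (gAct h) := by
  refine MvPolynomial.algHom_ext fun p => ?_
  rw [AlgHom.comp_apply, gAct_X, gAct_X, map_sum]
  simp_rw [map_mul, gAct_X, ← algebraMap_eq, AlgHom.commutes, algebraMap_eq, Finset.mul_sum]
  refine Eq.trans (Finset.sum_congr rfl fun k _ => ?_) Finset.sum_comm
  have : (g * h) p.1 k p.2 = ∑ l, g p.1 k l * h p.1 l p.2 := Matrix.mul_apply
  rw [this, map_sum, Finset.sum_mul]
  refine Finset.sum_congr rfl fun l _ => ?_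
  rw [map_mul]
  ring

theorem gAct_one : gAct (1 : Mats K v n) = AlgHom.id K _ := by
  refine MvPolynomial.algHom_ext fun p => ?_
  rw [gAct_X, Finset.sum_eq_single p.2]
  · simp
  · intro k _ hk
    simp [Matrix.one_apply_ne hk]
  · simp

theorem gAct_bijective (g : Mats K v n) (hg : ∀ i, IsUnit (g i).det) :
    Function.Bijective (gAct g) := by
  have h1 : g * (fun i => (g i)⁻¹) = 1 := funext fun i => Matrix.mul_nonsing_inv _ (hg i)
  have h2 : (fun i => (g i)⁻¹) * g = 1 := funext fun i => Matrix.nonsing_inv_mul _ (hg i)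
  rw [Function.bijective_iff_has_inverse]
  refine ⟨gAct fun i => (g i)⁻¹, fun f => ?_, fun f => ?_⟩
  · rw [← AlgHom.comp_apply, ← gAct_mul, h2, gAct_one, AlgHom.id_apply]
  · rw [← AlgHom.comp_apply, ← gAct_mul, h1, gAct_one, AlgHom.id_apply]

theorem gAct_X_isWeightedHomogeneous (g : Mats K v n) (p : MVar v n) :
    (gAct g (X p)).IsWeightedHomogeneous (wt v n) (wt v n p) := by
  rw [gAct_X]
  refine IsWeightedHomogeneous.sum _ _ _ fun k _ => IsWeightedHomogeneous.C_mul ?_ _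
  exact isWeightedHomogeneous_X K (wt v n) _

theorem gAct_monomial (g : Mats K v n) (m : MVar v n →₀ ℕ) (c : K) :
    gAct g (monomial m c) = C c * ∏ x ∈ m.support, gAct g (X x) ^ m x := by
  rw [monomial_eq, map_mul, Finsupp.prod, map_prod, ← algebraMap_eq, AlgHom.commutes]
  simp

theorem gAct_isWeightedHomogeneous (g : Mats K v n) {f : MvPolynomial (MVar v n) K}
    {a : Fin v → ℕ} (hf : f.IsWeightedHomogeneous (wt v n) a) :
    (gAct g f).IsWeightedHomogeneous (wt v n) a := by
  rw [f.as_sum, map_sum]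
  refine IsWeightedHomogeneous.sum _ _ _ fun m hm => ?_
  rw [gAct_monomial, ← hf (mem_support_iff.1 hm), Finsupp.weight_apply]
  exact (IsWeightedHomogeneous.prod _ _ _ fun x _ =>
    (gAct_X_isWeightedHomogeneous g x).pow (m x)).C_mul _

theorem gAct_weightedHomogeneousComponent (g : Mats K v n) (f : MvPolynomial (MVar v n) K)
    (a : Fin v → ℕ) :
    weightedHomogeneousComponent (wt v n) a (gAct g f) =
      gAct g (weightedHomogeneousComponent (wt v n) a f) := by
  classical
  induction f using MvPolynomial.induction_on' with
  | monomial m c =>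
    have h1 := isWeightedHomogeneous_monomial (wt v n) m c rfl
    rw [weightedHomogeneousComponent_of_mem h1,
      weightedHomogeneousComponent_of_mem (gAct_isWeightedHomogeneous g h1)]
    split_ifs <;> simp
  | add p q hp hq => simp only [map_add, hp, hq]

/-- The tuple of diagonal matrices with entries `t`. -/
def diagMats (t : MVar v n → K) : Mats K v n := fun i => Matrix.diagonal fun j => t ⟨i, j⟩

theorem gAct_diagMats_X (t : MVar v n → K) (p : MVar v n) :
    gAct (diagMats t) (X p) = C (t p) * X p := by
  rw [gAct_X, Finset.sum_eq_single p.2]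
  · simp [diagMats]
  · intro k _ hk
    simp [diagMats, Matrix.diagonal_apply_ne _ hk]
  · simp

theorem gAct_diagMats_monomial (t : MVar v n → K) (m : MVar v n →₀ ℕ) (c : K) :
    gAct (diagMats t) (monomial m c) = monomial m (c * eval t (monomial m 1)) := by
  rw [gAct_monomial, eval_monomial, one_mul, monomial_eq (s := m), map_mul, Finsupp.prod,
    Finsupp.prod, map_prod, mul_assoc, ← Finset.prod_mul_distrib]
  simp_rw [gAct_diagMats_X, mul_pow, map_pow]

/-- A linear functional evaluated at the torus orbit of `f`, as a polynomial in the torus. -/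
def torusPoly {σ : Type*} (l : MvPolynomial σ K →ₗ[K] K) (f : MvPolynomial σ K) :
    MvPolynomial σ K :=
  ∑ u ∈ f.support, monomial u (coeff u f * l (monomial u 1))

theorem coeff_torusPoly {σ : Type*} (l : MvPolynomial σ K →ₗ[K] K) (f : MvPolynomial σ K)
    (m : σ →₀ ℕ) : coeff m (torusPoly l f) = coeff m f * l (monomial m 1) := by
  classical
  rw [torusPoly, coeff_sum]
  simp only [coeff_monomial]
  rw [Finset.sum_ite_eq' f.support m]
  split_ifs with h
  · rfl
  · rw [notMem_support_iff.1 h, zero_mul]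

theorem eval_torusPoly (l : MvPolynomial (MVar v n) K →ₗ[K] K) (f : MvPolynomial (MVar v n) K)
    (t : MVar v n → K) : eval t (torusPoly l f) = l (gAct (diagMats t) f) := by
  conv_rhs => rw [f.as_sum]
  rw [torusPoly, map_sum, map_sum, map_sum]
  refine Finset.sum_congr rfl fun u _ => ?_
  have h1 : ∀ c : K, (monomial u c : MvPolynomial (MVar v n) K) = c • monomial u 1 := by
    intro c; simp [smul_monomial]
  rw [gAct_diagMats_monomial, h1 (coeff u f * l _), h1 (coeff u f * eval t _), smul_eval,
    LinearMap.map_smul, smul_eq_mul]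
  ring

/-- The action of a matrix with indeterminate entries. -/
def genAct : MvPolynomial (MVar v n) K →ₐ[K]
    MvPolynomial (MVar v n) (MvPolynomial (Σ i : Fin v, Fin (n i + 1) × Fin (n i + 1)) K) :=
  aeval fun p : MVar v n => ∑ k : Fin (n p.1 + 1), C (X ⟨p.1, (k, p.2)⟩) * X ⟨p.1, k⟩

/-- The entries of a tuple of matrices. -/
def entries (g : Mats K v n) : (Σ i : Fin v, Fin (n i + 1) × Fin (n i + 1)) → K :=
  fun q => g q.1 q.2.1 q.2.2

theorem eval_coeff_genAct (g : Mats K v n) (f : MvPolynomial (MVar v n) K)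
    (m : MVar v n →₀ ℕ) : eval (entries g) (coeff m (genAct f)) = coeff m (gAct g f) := by
  rw [← coeff_map]
  congr 1
  have : (((MvPolynomial.map (eval (entries g)) : MvPolynomial (MVar v n)
      (MvPolynomial (Σ i : Fin v, Fin (n i + 1) × Fin (n i + 1)) K) →+*
        MvPolynomial (MVar v n) K)).comp (genAct (K := K) (v := v) (n := n) : _ →+* _)) =
      (gAct g : MvPolynomial (MVar v n) K →+* _) := by
    refine MvPolynomial.ringHom_ext (fun c => ?_) fun p => ?_
    · simp only [RingHom.comp_apply, RingHom.coe_coe, ← algebraMap_eq, AlgHom.commutes]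
      rw [IsScalarTower.algebraMap_apply K
        (MvPolynomial (Σ i : Fin v, Fin (n i + 1) × Fin (n i + 1)) K), algebraMap_eq,
        algebraMap_eq, map_C, eval_C, algebraMap_eq]
    · simp [genAct, gAct_X, entries]
  exact congrArg (fun F : MvPolynomial (MVar v n) K →+* MvPolynomial (MVar v n) K => F f) this

/-- The tuple acting by `x_{i c} ↦ x_{i c} + s x_{i k}` and fixing the other variables. -/
def transv (i : Fin v) (k c : Fin (n i + 1)) (s : K) : Mats K v n :=
  Function.update 1 i (Matrix.transvection k c s)

theorem transv_mul (i : Fin v) {k c : Fin (n i + 1)} (h : k ≠ c) (s t : K) :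
    transv i k c s * transv i k c t = (transv i k c (s + t) : Mats K v n) := by
  funext j
  by_cases hj : j = i
  · subst hj
    simp [transv, Matrix.transvection_mul_transvection_same k c h]
  · simp [transv, hj]

theorem transv_zero (i : Fin v) (k c : Fin (n i + 1)) :
    (transv i k c 0 : Mats K v n) = 1 := by
  simp [transv]

theorem transv_det (i : Fin v) {k c : Fin (n i + 1)} (h : k ≠ c) (s : K) (j : Fin v) :
    IsUnit ((transv i k c s : Mats K v n) j).det := by
  by_cases hj : j = i
  · subst hj
    simp [transv, Matrix.det_transvection_of_ne k c h]
  · simp [transv, hj]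

theorem transv_upper (i : Fin v) {k c : Fin (n i + 1)} (h : k < c) (s : K) (j : Fin v)
    (p q : Fin (n j + 1)) (hpq : q < p) : (transv i k c s : Mats K v n) j p q = 0 := by
  by_cases hj : j = i
  · subst hj
    simp only [transv, Function.update_self, Matrix.transvection, Matrix.add_apply]
    rw [Matrix.one_apply_ne hpq.ne', Matrix.single_apply_of_ne, add_zero]
    rintro ⟨rfl, rfl⟩
    exact absurd (h.trans hpq) (lt_irrefl _)
  · simp [transv, hj, Matrix.one_apply_ne hpq.ne']

theorem gAct_transv_X (i : Fin v) (k c : Fin (n i + 1)) (s : K) (x : MVar v n) :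
    gAct (transv i k c s) (X x) = X x + if x = ⟨i, c⟩ then C s * X ⟨i, k⟩ else 0 := by
  classical
  obtain ⟨j, q⟩ := x
  rw [gAct_X]
  by_cases hj : j = i
  · subst hj
    have : ∀ l, C ((transv j k c s : Mats K v n) j l q) * X (⟨j, l⟩ : MVar v n) =
        (if l = q then X ⟨j, q⟩ else 0) +
          (if l = k then (if q = c then C s * X ⟨j, k⟩ else 0) else 0) := by
      intro l
      simp only [transv, Function.update_self, Matrix.transvection, Matrix.add_apply,
        Matrix.one_apply, Matrix.single_apply, map_add, add_mul]
      congr 1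
      · by_cases h : l = q
        · subst h; simp
        · simp [h]
      · by_cases h : l = k
        · subst h
          by_cases h' : q = c
          · subst h'; simp
          · simp [h', Ne.symm h']
        · simp [h, Ne.symm h]
    simp only [this, Finset.sum_add_distrib, Finset.sum_ite_eq', Finset.mem_univ, if_true]
    congr 1
    by_cases h' : q = c
    · subst h'; simp
    · rw [if_neg h', if_neg]
      intro he
      simp only [Sigma.mk.injEq, heq_eq_eq, true_and] at he
      exact h' he
  · rw [if_neg (by rintro ⟨⟩; exact hj rfl), add_zero, Finset.sum_eq_single q]
    · simp [transv, hj]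
    · intro l _ hl
      simp [transv, hj, Matrix.one_apply_ne hl]
    · simp

/-- The map of variables replacing `x_{i c}` by `x_{i k}`. -/
def rowMove (i : Fin v) (k c : Fin (n i + 1)) : MVar v n → MVar v n :=
  Function.update id ⟨i, c⟩ ⟨i, k⟩

/-- The transvection applied to `x^z` involves the monomial in which all occurrences of
`x_{i c}` are replaced by `x_{i k}`. -/
theorem mapDomain_rowMove_mem_support (i : Fin v) {k c : Fin (n i + 1)} (h : k ≠ c)
    (z : MVar v n →₀ ℕ) :
    Finsupp.mapDomain (rowMove i k c) z ∈ (gAct (transv i k c (1 : K)) (monomial z 1)).support := by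
  classical
  set ψ : MvPolynomial (MVar v n) K →ₐ[K] MvPolynomial (MVar v n) K :=
    aeval fun x => if x = ⟨i, c⟩ then 0 else X x with hψ
  have h1 : ψ.comp (gAct (transv i k c (1 : K))) = rename (rowMove i k c) := by
    refine MvPolynomial.algHom_ext fun x => ?_
    rw [AlgHom.comp_apply, gAct_transv_X, rename_X]
    by_cases hx : x = ⟨i, c⟩
    · subst hx
      simp [hψ, rowMove, h]
    · simp [hψ, rowMove, hx]
  have hmon : ∀ u : MVar v n →₀ ℕ, ∀ a : K, (ψ (monomial u a)).support ⊆ {u} := by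
    intro u a
    rw [hψ, aeval_monomial]
    by_cases hu : u ⟨i, c⟩ = 0
    · have : (u.prod fun x e => (if x = ⟨i, c⟩ then (0 : MvPolynomial (MVar v n) K) else X x) ^ e)
          = u.prod fun x e => X x ^ e := by
        refine Finset.prod_congr rfl fun x hx => ?_
        have hx' : x ≠ ⟨i, c⟩ := by
          rintro rfl
          exact (Finsupp.mem_support_iff.1 hx) hu
        simp only [if_neg hx']
      rw [this, algebraMap_eq, ← monomial_eq]
      exact support_monomial_subset
    · have : (u.prod fun x e => (if x = ⟨i, c⟩ then (0 : MvPolynomial (MVar v n) K) else X x) ^ e)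
          = 0 := by
        refine Finset.prod_eq_zero (Finsupp.mem_support_iff.2 hu) ?_
        simp [hu]
      rw [this, mul_zero]
      simp
  have hsupp : ∀ p, (ψ p).support ⊆ p.support := by
    intro p
    conv_lhs => rw [p.as_sum, map_sum]
    refine support_sum.trans (Finset.biUnion_subset.2 fun u hu => (hmon u _).trans ?_)
    simpa using hu
  apply hsupp
  rw [← AlgHom.comp_apply, h1, rename_monomial]
  simp

end Action

section GenericFilter

variable {K : Type} [Field K] {v : ℕ} {n : Fin v → ℕ}

variable (K v n) in
/-- The filter of the sets of tuples of matrices containing a general tuple. -/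
def genericFilter : Filter (Mats K v n) where
  sets := {s | Generically (· ∈ s)}
  univ_sets := ⟨1, one_ne_zero, fun _ _ _ => trivial⟩
  sets_of_superset := fun ⟨h, h0, hs⟩ hst => ⟨h, h0, fun g hg he => hst (hs g hg he)⟩
  inter_sets := fun ⟨h, h0, hs⟩ ⟨h', h0', hs'⟩ => ⟨h * h', mul_ne_zero h0 h0', fun g hg he => by
    rw [map_mul] at he
    exact ⟨hs g hg (left_ne_zero_of_mul he), hs' g hg (right_ne_zero_of_mul he)⟩⟩

theorem eventually_isUnit_det : ∀ᶠ g in genericFilter K v n, ∀ i, IsUnit (g i).det :=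
  ⟨1, one_ne_zero, fun _ hg _ => hg⟩

theorem eventually_eval_entries_ne_zero
    {p : MvPolynomial (Σ i : Fin v, Fin (n i + 1) × Fin (n i + 1)) K} (hp : p ≠ 0) :
    ∀ᶠ g in genericFilter K v n, eval (entries g) p ≠ 0 :=
  ⟨p, hp, fun _ _ h => h⟩

instance genericFilter_neBot [Infinite K] : (genericFilter K v n).NeBot := by
  rw [← Filter.forall_mem_nonempty_iff_neBot]
  rintro s ⟨h, h0, hs⟩
  set D : Fin v → MvPolynomial (Σ i : Fin v, Fin (n i + 1) × Fin (n i + 1)) K :=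
    fun i => (Matrix.of fun k j => X ⟨i, (k, j)⟩ : Matrix (Fin (n i + 1)) (Fin (n i + 1)) _).det
    with hD
  have hev : ∀ (g : Mats K v n) i, eval (entries g) (D i) = (g i).det := by
    intro g i
    rw [hD, RingHom.map_det]
    congr 1
    ext k j
    simp [entries]
  have hD0 : ∀ i, D i ≠ 0 := by
    intro i h0
    have := hev 1 i
    rw [h0] at this
    simp at this
  have hne : h * ∏ i, D i ≠ 0 := mul_ne_zero h0 (Finset.prod_ne_zero_iff.2 fun i _ => hD0 i)
  obtain ⟨x, hx⟩ : ∃ x, eval x (h * ∏ i, D i) ≠ 0 := by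
    by_contra! hcon
    exact hne (MvPolynomial.funext fun x => by rw [hcon x, map_zero])
  set g : Mats K v n := fun i k j => x ⟨i, (k, j)⟩ with hg
  have hgx : entries g = x := rfl
  rw [map_mul, map_prod] at hx
  refine ⟨g, hs g (fun i => ?_) (left_ne_zero_of_mul hx)⟩
  rw [← hev, isUnit_iff_ne_zero]
  exact Finset.prod_ne_zero_iff.1 (right_ne_zero_of_mul hx) i (Finset.mem_univ _)

end GenericFilter

section GradedPieces

variable {K : Type} [Field K] {v : ℕ} {n : Fin v → ℕ}

theorem weight_wt_apply (m : MVar v n →₀ ℕ) (i : Fin v) :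
    Finsupp.weight (wt v n) m i = ∑ j, m ⟨i, j⟩ := by
  rw [Finsupp.weight_apply, Finsupp.sum_fintype _ _ (by simp), Finset.sum_apply,
    Fintype.sum_sigma, Finset.sum_eq_single i]
  · simp [wt]
  · intro i' _ hi'
    simp [wt, Pi.single_eq_of_ne hi'.symm]
  · simp

theorem le_weight_wt (m : MVar v n →₀ ℕ) (x : MVar v n) :
    m x ≤ Finsupp.weight (wt v n) m x.1 := by
  rw [weight_wt_apply]
  exact Finset.single_le_sum (f := fun j => m ⟨x.1, j⟩) (fun _ _ => Nat.zero_le _)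
    (Finset.mem_univ x.2)

theorem finite_weight_eq (a : Fin v → ℕ) :
    {m : MVar v n →₀ ℕ | Finsupp.weight (wt v n) m = a}.Finite := by
  refine (Set.finite_Icc 0 (Finsupp.equivFunOnFinite.symm fun x : MVar v n => a x.1)).subset ?_
  rintro m rfl
  exact ⟨zero_le, fun x => le_weight_wt m x⟩

/-- The homogeneous part of degree `a` of an ideal. -/
def hpart (I : Ideal (MvPolynomial (MVar v n) K)) (a : Fin v → ℕ) :
    Submodule K (MvPolynomial (MVar v n) K) :=
  Submodule.restrictScalars K I ⊓ weightedHomogeneousSubmodule K (wt v n) a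

/-- The image of a subspace under `g`. -/
def gMap (g : Mats K v n) (W : Submodule K (MvPolynomial (MVar v n) K)) :
    Submodule K (MvPolynomial (MVar v n) K) :=
  W.map (gAct g).toLinearMap

theorem weight_eq_of_mem_leadSet (τ : MonomialOrder (MVar v n)) {a : Fin v → ℕ}
    {W : Submodule K (MvPolynomial (MVar v n) K)}
    (hW : W ≤ weightedHomogeneousSubmodule K (wt v n) a) {m : MVar v n →₀ ℕ}
    (hm : m ∈ leadSet τ W) : Finsupp.weight (wt v n) m = a := by
  obtain ⟨f, hf, hf0, rfl⟩ := hm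
  exact hW hf (τ.coeff_degree_ne_zero_iff.2 hf0)

theorem gMap_hpart_le (g : Mats K v n) (I : Ideal (MvPolynomial (MVar v n) K))
    (a : Fin v → ℕ) : gMap g (hpart I a) ≤ weightedHomogeneousSubmodule K (wt v n) a := by
  rintro _ ⟨p, hp, rfl⟩
  exact gAct_isWeightedHomogeneous g hp.2

theorem leadSet_gMap_hpart_finite (τ : MonomialOrder (MVar v n)) (g : Mats K v n)
    (I : Ideal (MvPolynomial (MVar v n) K)) (a : Fin v → ℕ) :
    (leadSet τ (gMap g (hpart I a))).Finite :=
  (finite_weight_eq a).subset fun _ hm => weight_eq_of_mem_leadSet τ (gMap_hpart_le g I a) hm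

theorem ncard_leadSet_gMap_hpart (τ : MonomialOrder (MVar v n)) {g : Mats K v n}
    (hg : ∀ i, IsUnit (g i).det) (I : Ideal (MvPolynomial (MVar v n) K)) (a : Fin v → ℕ) :
    (leadSet τ (gMap g (hpart I a))).ncard = hilb I a := by
  rw [← finrank_eq_ncard_leadSet]
  exact (LinearEquiv.finrank_eq (Submodule.equivMapOfInjective (gAct g).toLinearMap
    (gAct_bijective g hg).1 (hpart I a))).symm

theorem mem_leadSet_gMap_iff (τ : MonomialOrder (MVar v n)) (g : Mats K v n)
    {I : Ideal (MvPolynomial (MVar v n) K)} (hI : IsMultigraded I) (m : MVar v n →₀ ℕ) :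
    m ∈ leadSet τ (gMap g (I.restrictScalars K)) ↔
      m ∈ leadSet τ (gMap g (hpart I (Finsupp.weight (wt v n) m))) := by
  classical
  refine ⟨?_, fun h => leadSet_mono τ (Submodule.map_mono inf_le_left) h⟩
  rintro ⟨_, ⟨p, hp, rfl⟩, hf0, hd⟩
  change gAct g p ≠ 0 at hf0
  change τ.degree (gAct g p) = m at hd
  set a := Finsupp.weight (wt v n) m
  have hcoeff : ∀ u, coeff u (gAct g (weightedHomogeneousComponent (wt v n) a p)) =
      if Finsupp.weight (wt v n) u = a then coeff u (gAct g p) else 0 := by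
    intro u
    rw [← gAct_weightedHomogeneousComponent, coeff_weightedHomogeneousComponent]
  have hm : coeff m (gAct g (weightedHomogeneousComponent (wt v n) a p)) ≠ 0 := by
    rw [hcoeff, if_pos rfl, ← hd]
    exact τ.coeff_degree_ne_zero_iff.2 hf0
  refine ⟨_, ⟨weightedHomogeneousComponent (wt v n) a p, ⟨hI p hp a,
    weightedHomogeneousComponent_isWeightedHomogeneous a p⟩, rfl⟩, ?_, ?_⟩
  · intro h0
    exact hm ((congrArg (coeff m) h0).trans (coeff_zero m))
  · apply τ.toSyn.injective
    refine le_antisymm (τ.degree_le_iff.2 fun u hu => ?_)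
      (τ.le_degree (mem_support_iff.2 hm))
    rw [← hd]
    refine τ.le_degree (mem_support_iff.2 fun h0 => mem_support_iff.1 hu ?_)
    change coeff u (gAct g (weightedHomogeneousComponent (wt v n) a p)) = 0
    rw [hcoeff, h0, ite_self]

theorem leadSet_gMap_upward (τ : MonomialOrder (MVar v n)) {g : Mats K v n}
    (hg : ∀ i, IsUnit (g i).det) (I : Ideal (MvPolynomial (MVar v n) K))
    {m m' : MVar v n →₀ ℕ} (h : m ≤ m')
    (hm : m ∈ leadSet τ (gMap g (I.restrictScalars K))) :
    m' ∈ leadSet τ (gMap g (I.restrictScalars K)) := by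
  classical
  obtain ⟨_, ⟨p, hp, rfl⟩, hf0, hd⟩ := hm
  change gAct g p ≠ 0 at hf0
  change τ.degree (gAct g p) = m at hd
  obtain ⟨q, hq⟩ := (gAct_bijective g hg).2 (monomial (m' - m) 1)
  have h1 : (gAct g).toLinearMap (q * p) = monomial (m' - m) 1 * gAct g p := by
    rw [AlgHom.toLinearMap_apply, map_mul, hq]
  have h2 : (monomial (m' - m) (1 : K)) ≠ 0 := by simp
  refine ⟨_, ⟨q * p, I.mul_mem_left q hp, h1⟩, mul_ne_zero h2 hf0, ?_⟩
  rw [τ.degree_mul h2 hf0, τ.degree_monomial, if_neg one_ne_zero, hd, tsub_add_cancel_of_le h]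

end GradedPieces

section GenericInitial

variable {K : Type} [Field K] {v : ℕ} {n : Fin v → ℕ}

/-- The leading exponents of `g(I)` for `g` general with respect to an ultrafilter. -/
def genLead (τ : MonomialOrder (MVar v n)) (U : Ultrafilter (Mats K v n))
    (I : Ideal (MvPolynomial (MVar v n) K)) : Set (MVar v n →₀ ℕ) :=
  {m | ∀ᶠ g in (U : Filter (Mats K v n)), m ∈ leadSet τ (gMap g (I.restrictScalars K))}

/-- The elements of degree `a` of a set of exponents. -/
def degPart (M : Set (MVar v n →₀ ℕ)) (a : Fin v → ℕ) : Set (MVar v n →₀ ℕ) :=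
  {m ∈ M | Finsupp.weight (wt v n) m = a}

theorem degPart_finite (M : Set (MVar v n →₀ ℕ)) (a : Fin v → ℕ) : (degPart M a).Finite :=
  (finite_weight_eq a).subset fun _ h => h.2

variable (τ : MonomialOrder (MVar v n))

theorem leadSet_gMap_hpart_eq_degPart (g : Mats K v n) {I : Ideal (MvPolynomial (MVar v n) K)}
    (hI : IsMultigraded I) (a : Fin v → ℕ) :
    leadSet τ (gMap g (hpart I a)) = degPart (leadSet τ (gMap g (I.restrictScalars K))) a := by
  ext m
  refine ⟨fun h => ?_, fun ⟨h, h'⟩ => ?_⟩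
  · have h' := weight_eq_of_mem_leadSet τ (gMap_hpart_le g I a) h
    refine ⟨(mem_leadSet_gMap_iff τ g hI m).2 ?_, h'⟩
    rwa [h']
  · rw [← h']
    exact (mem_leadSet_gMap_iff τ g hI m).1 h

theorem eventually_leadSet_eq (U : Ultrafilter (Mats K v n))
    {I : Ideal (MvPolynomial (MVar v n) K)} (hI : IsMultigraded I) (a : Fin v → ℕ) :
    ∀ᶠ g in (U : Filter (Mats K v n)),
      leadSet τ (gMap g (hpart I a)) = degPart (genLead τ U I) a := by
  have key : ∀ᶠ g in (U : Filter (Mats K v n)),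
      ∀ m ∈ {m : MVar v n →₀ ℕ | Finsupp.weight (wt v n) m = a},
        (m ∈ leadSet τ (gMap g (I.restrictScalars K)) ↔ m ∈ genLead τ U I) := by
    refine (Filter.eventually_all_finite (finite_weight_eq a)).2 fun m _ => ?_
    by_cases hm : m ∈ genLead τ U I
    · filter_upwards [show ∀ᶠ g in (U : Filter (Mats K v n)), _ from hm] with g hg
      exact iff_of_true hg hm
    · filter_upwards [Ultrafilter.eventually_not.2 hm] with g hg
      exact iff_of_false hg hm
  filter_upwards [key] with g hg
  rw [leadSet_gMap_hpart_eq_degPart τ g hI]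
  ext m
  exact ⟨fun h => ⟨(hg m h.2).1 h.1, h.2⟩, fun h => ⟨(hg m h.2).2 h.1, h.2⟩⟩

theorem ncard_degPart_genLead {U : Ultrafilter (Mats K v n)}
    (hU : (U : Filter (Mats K v n)) ≤ genericFilter K v n)
    {I : Ideal (MvPolynomial (MVar v n) K)} (hI : IsMultigraded I) (a : Fin v → ℕ) :
    (degPart (genLead τ U I) a).ncard = hilb I a := by
  obtain ⟨g, hg, hdet⟩ := ((eventually_leadSet_eq τ U hI a).and
    (eventually_isUnit_det.filter_mono hU)).exists
  rw [← hg, ncard_leadSet_gMap_hpart τ hdet]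

theorem genLead_upward {U : Ultrafilter (Mats K v n)}
    (hU : (U : Filter (Mats K v n)) ≤ genericFilter K v n)
    (I : Ideal (MvPolynomial (MVar v n) K)) {m m' : MVar v n →₀ ℕ} (h : m ≤ m')
    (hm : m ∈ genLead τ U I) : m' ∈ genLead τ U I := by
  filter_upwards [show ∀ᶠ g in (U : Filter (Mats K v n)), _ from hm,
    eventually_isUnit_det.filter_mono hU] with g hg hdet
  exact leadSet_gMap_upward τ hdet I h hg

/-- Semicontinuity: independence of truncations at one tuple of matrices bounds the number of
generic leading exponents from below. -/
theorem card_le_ncard_genLead {U : Ultrafilter (Mats K v n)}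
    (hU : (U : Filter (Mats K v n)) ≤ genericFilter K v n)
    {I : Ideal (MvPolynomial (MVar v n) K)} (hI : IsMultigraded I) (a : Fin v → ℕ)
    {ι : Type*} [Fintype ι] (m : MVar v n →₀ ℕ) (B : Finset (MVar v n →₀ ℕ))
    (hB : ∀ u ∈ B, τ.toSyn m < τ.toSyn u) (p : ι → MvPolynomial (MVar v n) K)
    (hp : ∀ i, p i ∈ hpart I a) (g₀ : Mats K v n)
    (hli : LinearIndependent K fun i => coeffsAt B (gAct g₀ (p i))) :
    Fintype.card ι ≤ {u ∈ degPart (genLead τ U I) a | τ.toSyn m < τ.toSyn u}.ncard := by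
  classical
  set A : Matrix ι B (MvPolynomial (Σ i : Fin v, Fin (n i + 1) × Fin (n i + 1)) K) :=
    Matrix.of fun i b => coeff (b : MVar v n →₀ ℕ) (genAct (p i)) with hA
  have hrow : ∀ g, (A.map (eval (entries g))).row = fun i => coeffsAt B (gAct g (p i)) := by
    intro g
    funext i b
    exact eval_coeff_genAct g (p i) b
  obtain ⟨q, hq0, hq⟩ := exists_polynomial_linearIndependent A (entries g₀) (by rwa [hrow])
  obtain ⟨g, hg, hne⟩ := ((eventually_leadSet_eq τ U hI a).and
    ((eventually_eval_entries_ne_zero hq0).filter_mono hU)).exists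
  rw [← hg]
  refine card_le_ncard_leadSet τ (gMap g (hpart I a)) (leadSet_gMap_hpart_finite τ g I a) m B hB
    (fun i => gAct g (p i)) (fun i => ⟨p i, hp i, rfl⟩) ?_
  rw [← hrow]
  exact hq _ hne

/-- Transvections with `k < c` only produce exponents which are at least as large. -/
theorem le_of_mem_support_gAct_transv (hτ : RespectsVarOrder τ) (i : Fin v)
    {k c : Fin (n i + 1)} (hkc : k < c) (s : K) (z : MVar v n →₀ ℕ) :
    ∀ u ∈ (gAct (transv i k c s) (monomial z 1)).support, τ.toSyn z ≤ τ.toSyn u := by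
  classical
  have hmul : ∀ (f g : MvPolynomial (MVar v n) K) (d e : MVar v n →₀ ℕ),
      (∀ u ∈ f.support, τ.toSyn d ≤ τ.toSyn u) → (∀ u ∈ g.support, τ.toSyn e ≤ τ.toSyn u) →
      ∀ u ∈ (f * g).support, τ.toSyn (d + e) ≤ τ.toSyn u := by
    intro f g d e hf hg u hu
    obtain ⟨u₁, h₁, u₂, h₂, rfl⟩ := Finset.mem_add.1 (support_mul f g hu)
    rw [map_add, map_add]
    exact add_le_add (hf _ h₁) (hg _ h₂)
  have hone : ∀ u ∈ (1 : MvPolynomial (MVar v n) K).support,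
      τ.toSyn (0 : MVar v n →₀ ℕ) ≤ τ.toSyn u := by
    intro u _
    exact τ.toSyn_monotone zero_le
  have hX : ∀ x : MVar v n, ∀ u ∈ (gAct (transv i k c s) (X x)).support,
      τ.toSyn (Finsupp.single x 1) ≤ τ.toSyn u := by
    intro x u hu
    rw [gAct_transv_X] at hu
    rcases Finset.mem_union.1 (support_add hu) with hu | hu
    · rw [support_X, Finset.mem_singleton] at hu
      rw [hu]
    · split_ifs at hu with hx
      · rw [← smul_eq_C_mul] at hu
        have := support_smul hu
        rw [support_X, Finset.mem_singleton] at this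
        rw [this, hx]
        exact (hτ i k c hkc).le
      · simp at hu
  induction z using Finsupp.induction_linear with
  | zero => rw [monomial_zero', C_1, map_one]; exact hone
  | add f g hf hg =>
    rw [← one_mul (1 : K), ← monomial_mul, map_mul]
    exact hmul _ _ _ _ hf hg
  | single x e =>
    rw [← X_pow_eq_monomial, map_pow]
    induction e with
    | zero => rw [pow_zero, Finsupp.single_zero]; exact hone
    | succ e ih =>
      rw [pow_succ, Finsupp.single_add]
      exact hmul _ _ _ _ ih (hX x)

/-- Every generic leading monomial is the image under a transvection of a combination of generic
leading monomials. -/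
theorem exists_gAct_transv_eq_monomial [Infinite K] (hτ : RespectsVarOrder τ)
    {U : Ultrafilter (Mats K v n)} (hU : (U : Filter (Mats K v n)) ≤ genericFilter K v n)
    {I : Ideal (MvPolynomial (MVar v n) K)} (hI : IsMultigraded I) (i : Fin v)
    {k c : Fin (n i + 1)} (hkc : k < c) (s : K) {m : MVar v n →₀ ℕ} (hm : m ∈ genLead τ U I) :
    ∃ y : MvPolynomial (MVar v n) K, (y.support : Set (MVar v n →₀ ℕ)) ⊆ genLead τ U I ∧
      gAct (transv i k c s) y = monomial m 1 := by
  classical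
  set a := Finsupp.weight (wt v n) m with ha
  set M := degPart (genLead τ U I) a with hM
  have hMfin : M.Finite := degPart_finite _ _
  have hTfin : {u ∈ M | τ.toSyn m ≤ τ.toSyn u}.Finite := hMfin.subset (Set.sep_subset _ _)
  have hBfin : {u : MVar v n →₀ ℕ | Finsupp.weight (wt v n) u = a ∧
      τ.toSyn m < τ.toSyn u}.Finite := (finite_weight_eq a).subset fun _ h => h.1
  set T := hTfin.toFinset with hT
  set B := hBfin.toFinset with hB
  have hTM : ∀ u ∈ T, u ∈ M ∧ τ.toSyn m ≤ τ.toSyn u := fun u hu => hTfin.mem_toFinset.1 hu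
  have hBm : ∀ u ∈ B, τ.toSyn m < τ.toSyn u := fun u hu => (hBfin.mem_toFinset.1 hu).2
  have hinj := (gAct_bijective _ (transv_det (K := K) i hkc.ne s)).1
  have hdep : ¬ LinearIndependent K fun u : T =>
      coeffsAt B (gAct (transv i k c s) (monomial (u : MVar v n →₀ ℕ) 1)) := by
    intro hli
    obtain ⟨g, hg⟩ := (eventually_leadSet_eq τ U hI a).exists
    have hp : ∀ u : T, ∃ p ∈ hpart I a, τ.degree (gAct g p) = u ∧
        coeff (u : MVar v n →₀ ℕ) (gAct g p) = 1 := by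
      intro u
      have h1 : (u : MVar v n →₀ ℕ) ∈ leadSet τ (gMap g (hpart I a)) := by
        rw [hg]
        exact (hTM u u.2).1
      obtain ⟨_, ⟨p, hp, rfl⟩, hf0, hd⟩ := h1
      change gAct g p ≠ 0 at hf0
      change τ.degree (gAct g p) = u at hd
      have hc : coeff (u : MVar v n →₀ ℕ) (gAct g p) ≠ 0 := by
        rw [← hd]
        exact τ.coeff_degree_ne_zero_iff.2 hf0
      refine ⟨(coeff (u : MVar v n →₀ ℕ) (gAct g p))⁻¹ • p, Submodule.smul_mem _ _ hp, ?_, ?_⟩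
      · rw [map_smul, τ.degree_smul_of_isRegular (isRegular_iff_ne_zero.2 (inv_ne_zero hc)), hd]
      · rw [map_smul, coeff_smul, smul_eq_mul, inv_mul_cancel₀ hc]
    choose p hpI hpd hpc using hp
    set l : B → MvPolynomial (MVar v n) K →ₗ[K] K := fun b =>
      (lcoeff K (b : MVar v n →₀ ℕ)).comp (gAct (transv i k c s)).toLinearMap with hl
    set A : Matrix T B (MvPolynomial (MVar v n) K) :=
      Matrix.of fun u b => torusPoly (l b) (gAct g (p u)) with hA
    obtain ⟨t, ht⟩ := exists_eval_linearIndependent τ A (fun u => (u : MVar v n →₀ ℕ))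
      (by
        intro u b
        refine τ.degree_le_iff.2 fun w hw => ?_
        rw [← hpd u]
        refine τ.le_degree (mem_support_iff.2 fun h0 => mem_support_iff.1 hw ?_)
        rw [hA, Matrix.of_apply, coeff_torusPoly, h0, zero_mul])
      (by
        convert hli using 1
        funext u b
        change coeff (u : MVar v n →₀ ℕ) (torusPoly (l b) (gAct g (p u))) = _
        rw [coeff_torusPoly, hpc, one_mul]
        rfl)
    have hcard := card_le_ncard_genLead τ hU hI a m B hBm p hpI
      (transv i k c s * diagMats t * g) (by
        convert ht using 1
        funext u b
        change coeff (b : MVar v n →₀ ℕ) _ = eval t (torusPoly (l b) (gAct g (p u)))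
        rw [eval_torusPoly, gAct_mul, gAct_mul]
        rfl)
    rw [Fintype.card_coe, ← Set.ncard_coe_finset, hT, hTfin.coe_toFinset] at hcard
    refine absurd hcard (not_le.2 (Set.ncard_lt_ncard ?_ hTfin))
    have hsub : {u ∈ M | τ.toSyn m < τ.toSyn u} ⊆ {u ∈ M | τ.toSyn m ≤ τ.toSyn u} :=
      fun u hu => ⟨hu.1, hu.2.le⟩
    rw [Set.ssubset_iff_of_subset hsub]
    exact ⟨m, ⟨⟨hm, rfl⟩, le_rfl⟩, fun h => lt_irrefl _ h.2⟩
  obtain ⟨r, hr, u₀, hu₀⟩ := Fintype.not_linearIndependent_iff.1 hdep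
  set y : MvPolynomial (MVar v n) K := ∑ u : T, monomial (u : MVar v n →₀ ℕ) (r u) with hy
  have hyc : ∀ w, coeff w y = if h : w ∈ T then r ⟨w, h⟩ else 0 := by
    intro w
    rw [hy, coeff_sum]
    split_ifs with h
    · rw [Finset.sum_eq_single (⟨w, h⟩ : T)]
      · simp
      · intro u _ hu
        rw [coeff_monomial, if_neg fun h' => hu (Subtype.ext h')]
      · simp
    · refine Finset.sum_eq_zero fun u _ => ?_
      rw [coeff_monomial, if_neg]
      rintro rfl
      exact h u.2
  have hyT : ∀ w ∈ y.support, w ∈ T := by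
    intro w hw
    by_contra h
    rw [mem_support_iff, hyc, dif_neg h] at hw
    exact hw rfl
  have hy0 : y ≠ 0 := by
    intro h0
    have := hyc u₀
    rw [h0, coeff_zero, dif_pos u₀.2] at this
    exact hu₀ this.symm
  have hgy : gAct (transv i k c s) y =
      ∑ u : T, r u • gAct (transv i k c s) (monomial (u : MVar v n →₀ ℕ) 1) := by
    rw [hy, map_sum]
    refine Finset.sum_congr rfl fun u _ => ?_
    rw [← map_smul, smul_monomial, smul_eq_mul, mul_one]
  have hsupp : ∀ w ∈ (gAct (transv i k c s) y).support, w = m := by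
    intro w hw
    have hweight : Finsupp.weight (wt v n) w = a := by
      have hyh : y.IsWeightedHomogeneous (wt v n) a := fun {d} hd =>
        (hTM d (hyT d (mem_support_iff.2 hd))).1.2
      exact gAct_isWeightedHomogeneous _ hyh (mem_support_iff.1 hw)
    have hle : τ.toSyn m ≤ τ.toSyn w := by
      by_contra hlt
      refine mem_support_iff.1 hw ?_
      rw [hgy, coeff_sum]
      refine Finset.sum_eq_zero fun u _ => ?_
      rw [coeff_smul, notMem_support_iff.1, smul_zero]
      intro h
      exact hlt ((hTM u u.2).2.trans (le_of_mem_support_gAct_transv τ hτ i hkc s _ w h))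
    by_contra hne
    have hlt : τ.toSyn m < τ.toSyn w :=
      lt_of_le_of_ne hle fun h => hne (τ.toSyn.injective h).symm
    have hwB : w ∈ B := hBfin.mem_toFinset.2 ⟨hweight, hlt⟩
    refine mem_support_iff.1 hw ?_
    have h2 := congrFun hr ⟨w, hwB⟩
    rw [Finset.sum_apply] at h2
    rw [hgy, coeff_sum]
    exact h2
  have hgy0 : gAct (transv i k c s) y ≠ 0 := by
    rw [← map_zero (gAct (transv i k c s))]
    exact hinj.ne hy0
  have heq : gAct (transv i k c s) y = monomial m (coeff m (gAct (transv i k c s) y)) := by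
    ext w
    rw [coeff_monomial]
    split_ifs with h
    · rw [h]
    · exact notMem_support_iff.1 fun hw => h (hsupp w hw).symm
  have hc : coeff m (gAct (transv i k c s) y) ≠ 0 := by
    intro h0
    rw [h0, monomial_zero] at heq
    exact hgy0 heq
  refine ⟨(coeff m (gAct (transv i k c s) y))⁻¹ • y, fun w hw => ?_, ?_⟩
  · exact (hTM w (hyT w (support_smul hw))).1.1
  · rw [map_smul, heq, coeff_monomial, if_pos rfl, smul_monomial, smul_eq_mul,
      inv_mul_cancel₀ hc]

/-- The set of generic leading exponents is closed under Borel moves. -/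
theorem mapDomain_rowMove_mem_genLead [Infinite K] (hτ : RespectsVarOrder τ)
    {U : Ultrafilter (Mats K v n)} (hU : (U : Filter (Mats K v n)) ≤ genericFilter K v n)
    {I : Ideal (MvPolynomial (MVar v n) K)} (hI : IsMultigraded I) (i : Fin v)
    {k c : Fin (n i + 1)} (hkc : k < c) {m : MVar v n →₀ ℕ} (hm : m ∈ genLead τ U I) :
    Finsupp.mapDomain (rowMove i k c) m ∈ genLead τ U I := by
  obtain ⟨y, hy, hym⟩ := exists_gAct_transv_eq_monomial τ hτ hU hI i hkc (-1 : K) hm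
  have h1 : gAct (transv i k c 1) (monomial m 1) = y := by
    rw [← hym, ← AlgHom.comp_apply, ← gAct_mul, transv_mul i hkc.ne, add_neg_cancel,
      transv_zero, gAct_one, AlgHom.id_apply]
  have h2 := mapDomain_rowMove_mem_support (K := K) i hkc.ne m
  rw [h1] at h2
  exact hy h2

end GenericInitial

section BorelFixedIdeals

variable {K : Type} [Field K] {v : ℕ} {n : Fin v → ℕ}

/-- The exponents of the monomials in an ideal. -/
def expSet (J : Ideal (MvPolynomial (MVar v n) K)) : Set (MVar v n →₀ ℕ) :=
  {m | monomial m 1 ∈ J}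

theorem expSet_upward {J : Ideal (MvPolynomial (MVar v n) K)} {m m' : MVar v n →₀ ℕ}
    (h : m ≤ m') (hm : m ∈ expSet J) : m' ∈ expSet J := by
  have : (monomial m' (1 : K)) = monomial (m' - m) 1 * monomial m 1 := by
    rw [monomial_mul, tsub_add_cancel_of_le h, one_mul]
  change monomial m' 1 ∈ J
  rw [this]
  exact J.mul_mem_left _ hm

theorem mem_expSet_of_nsmul_mem {J : Ideal (MvPolynomial (MVar v n) K)} (hJ : J.IsRadical)
    {m : MVar v n →₀ ℕ} {N : ℕ} (hm : N • m ∈ expSet J) : m ∈ expSet J := by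
  refine hJ ⟨N, ?_⟩
  rw [monomial_pow, one_pow]
  exact hm

theorem mem_of_support_subset_expSet {J : Ideal (MvPolynomial (MVar v n) K)}
    {f : MvPolynomial (MVar v n) K} (h : (f.support : Set _) ⊆ expSet J) : f ∈ J := by
  rw [f.as_sum]
  refine J.sum_mem fun m hm => ?_
  have : monomial m (coeff m f) = C (coeff m f) * monomial m 1 := by
    rw [C_mul_monomial, mul_one]
  rw [this]
  exact J.mul_mem_left _ (h hm)

theorem BorelFixed.gAct_mem {J : Ideal (MvPolynomial (MVar v n) K)} (hJ : BorelFixed J)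
    {g : Mats K v n} (hg : ∀ i, IsUnit (g i).det)
    (hup : ∀ (i : Fin v) (k j : Fin (n i + 1)), j < k → g i k j = 0)
    {f : MvPolynomial (MVar v n) K} (hf : f ∈ J) : gAct g f ∈ J := by
  have := Ideal.mem_map_of_mem (gAct g) hf
  rwa [hJ g hg hup] at this

/-- A Borel fixed ideal is a monomial ideal. -/
theorem BorelFixed.support_subset [Infinite K] {J : Ideal (MvPolynomial (MVar v n) K)}
    (hJ : BorelFixed J) {f : MvPolynomial (MVar v n) K} (hf : f ∈ J) :
    (f.support : Set (MVar v n →₀ ℕ)) ⊆ expSet J := by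
  intro m hm
  by_contra hmJ
  obtain ⟨l, hl, hlJ⟩ := Submodule.exists_le_ker_of_notMem
    (p := J.restrictScalars K) (v := monomial m (1 : K)) hmJ
  have hzero : torusPoly l f * ∏ x, X x = 0 := by
    refine MvPolynomial.funext fun t => ?_
    rw [map_mul, map_prod, map_zero]
    by_cases ht : ∀ x, t x ≠ 0
    · have hdet : ∀ i, IsUnit ((diagMats t : Mats K v n) i).det := by
        intro i
        rw [diagMats, Matrix.det_diagonal, isUnit_iff_ne_zero]
        exact Finset.prod_ne_zero_iff.2 fun j _ => ht _
      have := hJ.gAct_mem hdet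
        (fun i k j hjk => Matrix.diagonal_apply_ne _ hjk.ne') hf
      rw [eval_torusPoly, LinearMap.mem_ker.1 (hlJ this), zero_mul]
    · push Not at ht
      obtain ⟨x, hx⟩ := ht
      rw [Finset.prod_eq_zero (Finset.mem_univ x) (by rw [eval_X, hx]), mul_zero]
  have h0 : torusPoly l f = 0 := (mul_eq_zero.1 hzero).resolve_right
    (Finset.prod_ne_zero_iff.2 fun x _ => X_ne_zero x)
  have h1 := coeff_torusPoly l f m
  rw [h0, coeff_zero] at h1
  exact mul_ne_zero (mem_support_iff.1 hm) hl h1.symm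

theorem BorelFixed.mapDomain_rowMove_mem [Infinite K] {J : Ideal (MvPolynomial (MVar v n) K)}
    (hJ : BorelFixed J) (i : Fin v) {k c : Fin (n i + 1)} (hkc : k < c) {m : MVar v n →₀ ℕ}
    (hm : m ∈ expSet J) : Finsupp.mapDomain (rowMove i k c) m ∈ expSet J :=
  hJ.support_subset (hJ.gAct_mem (transv_det i hkc.ne 1) (transv_upper i hkc 1) hm)
    (mapDomain_rowMove_mem_support i hkc.ne m)

theorem BorelFixed.ncard_degPart_expSet [Infinite K] (τ : MonomialOrder (MVar v n))
    {J : Ideal (MvPolynomial (MVar v n) K)} (hJ : BorelFixed J) (a : Fin v → ℕ) :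
    (degPart (expSet J) a).ncard = hilb J a := by
  classical
  have h := finrank_eq_ncard_leadSet τ (hpart J a)
  change hilb J a = _ at h
  rw [h]
  congr 1
  ext m
  constructor
  · rintro ⟨hm, rfl⟩
    refine ⟨monomial m 1, ⟨hm, isWeightedHomogeneous_monomial _ _ _ rfl⟩, by simp, ?_⟩
    rw [τ.degree_monomial, if_neg one_ne_zero]
  · rintro ⟨f, hf, hf0, rfl⟩
    exact ⟨hJ.support_subset hf.1 (τ.degree_mem_support hf0),
      hf.2 (τ.coeff_degree_ne_zero_iff.2 hf0)⟩

theorem mem_map_gAct_iff {g : Mats K v n} (hg : ∀ i, IsUnit (g i).det)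
    (I : Ideal (MvPolynomial (MVar v n) K)) (f : MvPolynomial (MVar v n) K) :
    f ∈ Ideal.map (gAct g) I ↔ f ∈ gMap g (I.restrictScalars K) :=
  Ideal.mem_map_iff_of_surjective (gAct g) (gAct_bijective g hg).2

/-- The initial ideal is determined by the leading exponents. -/
theorem BorelFixed.inIdeal_map_eq [Infinite K] (τ : MonomialOrder (MVar v n))
    {J : Ideal (MvPolynomial (MVar v n) K)} (hJ : BorelFixed J) {g : Mats K v n}
    (hg : ∀ i, IsUnit (g i).det) {I : Ideal (MvPolynomial (MVar v n) K)}
    (h : leadSet τ (gMap g (I.restrictScalars K)) = expSet J) :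
    inIdeal τ (Ideal.map (gAct g) I) = J := by
  refine le_antisymm (Ideal.span_le.2 ?_) fun f hf => ?_
  · rintro _ ⟨f, hf, hf0, rfl⟩
    have : τ.degree f ∈ expSet J := by
      rw [← h]
      exact ⟨f, (mem_map_gAct_iff hg I f).1 hf, hf0, rfl⟩
    exact this
  · refine mem_of_support_subset_expSet ((hJ.support_subset hf).trans ?_)
    rw [← h]
    rintro m ⟨f, hf, hf0, rfl⟩
    exact Ideal.subset_span ⟨f, (mem_map_gAct_iff hg I f).2 hf, hf0, rfl⟩

end BorelFixedIdeals

section BorelSets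

variable {v : ℕ} {n : Fin v → ℕ}

/-- The properties of the set of exponents of a Borel fixed monomial ideal: it is closed under
divisibility and under replacing all occurrences of a variable by an earlier one of its row. -/
structure IsBorelSet (M : Set (MVar v n →₀ ℕ)) : Prop where
  upward : ∀ {m m' : MVar v n →₀ ℕ}, m ≤ m' → m ∈ M → m' ∈ M
  move : ∀ (i : Fin v) {k c : Fin (n i + 1)}, k < c → ∀ {m : MVar v n →₀ ℕ}, m ∈ M →
    Finsupp.mapDomain (rowMove i k c) m ∈ M

/-- The map collapsing row `i` to its variable with index `k i`. -/
def collapse (k : ∀ i : Fin v, Fin (n i + 1)) : MVar v n → MVar v n := fun x => ⟨x.1, k x.1⟩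

theorem IsBorelSet.mapDomain_collapse_mem {M : Set (MVar v n →₀ ℕ)} (hM : IsBorelSet M)
    (k : ∀ i : Fin v, Fin (n i + 1)) {u : MVar v n →₀ ℕ} (hu : u ∈ M)
    (hk : ∀ x, u x ≠ 0 → k x.1 ≤ x.2) : Finsupp.mapDomain (collapse k) u ∈ M := by
  classical
  have key : ∀ T : Finset (MVar v n), (∀ x ∈ T, k x.1 < x.2) →
      Finsupp.mapDomain (fun x => if x ∈ T then collapse k x else x) u ∈ M := by
    intro T
    induction T using Finset.induction_on with
    | empty =>
      intro _
      simpa using (Finsupp.mapDomain_id (v := u)).symm ▸ hu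
    | insert y T hy ih =>
      intro hT
      have h1 := hM.move y.1 (hT y (Finset.mem_insert_self _ _))
        (ih fun x hx => hT x (Finset.mem_insert_of_mem hx))
      rw [← Finsupp.mapDomain_comp] at h1
      convert h1 using 2
      funext x
      by_cases hxT : x ∈ T
      · have hne : collapse k x ≠ ⟨y.1, y.2⟩ := by
          intro h
          have := hT y (Finset.mem_insert_self _ _)
          have hxy : (collapse k x).1 = y.1 := congrArg Sigma.fst h
          obtain ⟨x1, x2⟩ := x
          obtain ⟨y1, y2⟩ := y
          obtain rfl : x1 = y1 := hxy
          simp only [collapse, Sigma.mk.injEq, heq_eq_eq, true_and] at h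
          exact this.ne h
        simp [hxT, rowMove, Function.update_of_ne hne]
      · by_cases hxy : x = y
        · subst hxy
          simp [hxT, rowMove, collapse]
        · have hne : x ≠ ⟨y.1, y.2⟩ := hxy
          simp [hxT, hxy, rowMove]
  have h1 := key (Finset.univ.filter fun x => k x.1 < x.2) fun x hx => (Finset.mem_filter.1 hx).2
  convert h1 using 1
  refine Finsupp.mapDomain_congr fun x hx => ?_
  split_ifs with h
  · rfl
  · have h2 : ¬ k x.1 < x.2 := fun h' => h (Finset.mem_filter.2 ⟨Finset.mem_univ _, h'⟩)
    have h3 : k x.1 = x.2 := le_antisymm (hk x (Finsupp.mem_support_iff.1 hx)) (not_lt.1 h2)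
    simp [collapse, h3]

theorem weight_mapDomain_collapse (k : ∀ i : Fin v, Fin (n i + 1)) (u : MVar v n →₀ ℕ) :
    Finsupp.weight (wt v n) (Finsupp.mapDomain (collapse k) u) = Finsupp.weight (wt v n) u :=
  Finsupp.linearCombination_mapDomain ℕ (v' := wt v n) (collapse k) u

theorem mapDomain_collapse_le (k : ∀ i : Fin v, Fin (n i + 1)) (u w : MVar v n →₀ ℕ)
    (h : ∀ i, Finsupp.weight (wt v n) u i ≤ w ⟨i, k i⟩) :
    Finsupp.mapDomain (collapse k) u ≤ w := by
  intro x
  by_cases hx : x ∈ Set.range (collapse k)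
  · obtain ⟨y, rfl⟩ := hx
    refine (le_weight_wt _ _).trans ?_
    rw [weight_mapDomain_collapse]
    exact h _
  · rw [Finsupp.mapDomain_of_notMem_range _ _ hx]
    exact Nat.zero_le _

theorem mapDomain_rowMove_eq (i : Fin v) (k c : Fin (n i + 1)) (z : MVar v n →₀ ℕ) :
    Finsupp.mapDomain (rowMove i k c) z =
      Finsupp.single ⟨i, k⟩ (z ⟨i, c⟩) + Finsupp.erase ⟨i, c⟩ z := by
  classical
  conv_lhs => rw [← Finsupp.single_add_erase (⟨i, c⟩ : MVar v n) z]
  rw [Finsupp.mapDomain_add, Finsupp.mapDomain_single]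
  congr 1
  · simp [rowMove]
  · conv_rhs => rw [← Finsupp.mapDomain_id (v := Finsupp.erase (⟨i, c⟩ : MVar v n) z)]
    refine Finsupp.mapDomain_congr fun x hx => ?_
    rw [Finsupp.support_erase, Finset.mem_erase] at hx
    simp [rowMove, Function.update_of_ne hx.1]

/-- Generators of an upward closed set have bounded exponents. -/
theorem exists_le_mem_bounded (M : Set (MVar v n →₀ ℕ)) :
    ∃ D : ℕ, ∀ m ∈ M, ∃ z ∈ M, z ≤ m ∧ ∀ x, z x ≤ D := by
  have hfin : {z | Minimal (· ∈ M) z}.Finite :=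
    WellQuasiOrderedLE.finite_of_isAntichain (setOfPred_minimal_antichain _)
  refine ⟨hfin.toFinset.sup fun z => Finset.univ.sup z, fun m hm => ?_⟩
  obtain ⟨z, hzm, hz⟩ := exists_minimal_le_of_wellFoundedLT (· ∈ M) m hm
  refine ⟨z, hz.prop, hzm, fun x => ?_⟩
  exact (Finset.le_sup (f := z) (Finset.mem_univ x)).trans
    (Finset.le_sup (f := fun z : MVar v n →₀ ℕ => Finset.univ.sup z) (hfin.mem_toFinset.2 hz))

/-- Large powers of the last allowed variable can be cancelled. -/
theorem IsBorelSet.exists_stable {M : Set (MVar v n →₀ ℕ)} (hM : IsBorelSet M) :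
    ∃ N : ℕ, ∀ (i : Fin v) (c : Fin (n i + 1)) (w : MVar v n →₀ ℕ),
      (∀ j, w ⟨i, j⟩ ≠ 0 → j ≤ c) → N ≤ Finsupp.weight (wt v n) w i →
        w + Finsupp.single ⟨i, c⟩ 1 ∈ M → w ∈ M := by
  classical
  obtain ⟨D, hD⟩ := exists_le_mem_bounded M
  refine ⟨2 * D * (∑ i, (n i + 1)) + 1, fun i c w hw hN hmem => ?_⟩
  obtain ⟨z, hzM, hzw, hzD⟩ := hD _ hmem
  have hz : ∀ x, x ≠ ⟨i, c⟩ → z x ≤ w x := by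
    intro x hx
    have := hzw x
    rwa [Finsupp.add_apply, Finsupp.single_eq_of_ne hx, add_zero] at this
  by_cases hc : z ⟨i, c⟩ ≤ w ⟨i, c⟩
  · refine hM.upward (fun x => ?_) hzM
    by_cases hx : x = ⟨i, c⟩
    · rw [hx]
      exact hc
    · exact hz x hx
  · have hwc : w ⟨i, c⟩ ≤ 2 * D := by
      have := hzD ⟨i, c⟩
      omega
    obtain ⟨k, hk⟩ : ∃ k, 2 * D < w ⟨i, k⟩ := by
      by_contra! hcon
      rw [weight_wt_apply] at hN
      have h1 : ∑ j, w ⟨i, j⟩ ≤ ∑ _j : Fin (n i + 1), 2 * D :=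
        Finset.sum_le_sum fun j _ => hcon j
      rw [Finset.sum_const, Finset.card_univ, Fintype.card_fin, smul_eq_mul, mul_comm] at h1
      have h2 : 2 * D * (n i + 1) ≤ 2 * D * ∑ i, (n i + 1) :=
        Nat.mul_le_mul_left _ (Finset.single_le_sum (f := fun i => n i + 1)
          (fun _ _ => Nat.zero_le _) (Finset.mem_univ i))
      omega
    have hkc : k < c := by
      refine lt_of_le_of_ne (hw k (by omega)) ?_
      rintro rfl
      omega
    refine hM.upward (fun x => ?_) (hM.move i hkc hzM)
    rw [mapDomain_rowMove_eq, Finsupp.add_apply]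
    by_cases hx : x = ⟨i, k⟩
    · subst hx
      rw [Finsupp.single_eq_same]
      have h1 := hzD ⟨i, c⟩
      have h2 := hzD ⟨i, k⟩
      have h3 : Finsupp.erase (⟨i, c⟩ : MVar v n) z ⟨i, k⟩ ≤ z ⟨i, k⟩ := by
        rw [Finsupp.erase_apply]
        split_ifs <;> simp
      omega
    · rw [Finsupp.single_eq_of_ne hx, zero_add, Finsupp.erase_apply]
      split_ifs with hxc
      · exact Nat.zero_le _
      · exact hz x hxc

/-- The exponents of degree `a` outside `M` involving only the first `c i` variables of row
`i`. -/
def outside (M : Set (MVar v n →₀ ℕ)) (c a : Fin v → ℕ) : Set (MVar v n →₀ ℕ) :=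
  {w | Finsupp.weight (wt v n) w = a ∧ (∀ x, w x ≠ 0 → (x.2 : ℕ) < c x.1) ∧ w ∉ M}

theorem outside_finite (M : Set (MVar v n →₀ ℕ)) (c a : Fin v → ℕ) : (outside M c a).Finite :=
  (finite_weight_eq a).subset fun _ h => h.1

theorem weight_single (i : Fin v) (d : Fin (n i + 1)) :
    Finsupp.weight (wt v n) (Finsupp.single (⟨i, d⟩ : MVar v n) 1) = Pi.single i 1 := by
  rw [Finsupp.weight_single, one_smul, wt]

theorem ncard_outside_succ {M : Set (MVar v n →₀ ℕ)} (hM : IsBorelSet M) {N : ℕ}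
    (hN : ∀ (i : Fin v) (c : Fin (n i + 1)) (w : MVar v n →₀ ℕ),
      (∀ j, w ⟨i, j⟩ ≠ 0 → j ≤ c) → N ≤ Finsupp.weight (wt v n) w i →
        w + Finsupp.single ⟨i, c⟩ 1 ∈ M → w ∈ M)
    (c b : Fin v → ℕ) (i : Fin v) (hci : c i < n i + 1) (hb : N ≤ b i) :
    (outside M (Function.update c i (c i + 1)) (b + Pi.single i 1)).ncard =
      (outside M (Function.update c i (c i + 1)) b).ncard +
        (outside M c (b + Pi.single i 1)).ncard := by
  classical
  set d : Fin (n i + 1) := ⟨c i, hci⟩ with hd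
  set c' := Function.update c i (c i + 1) with hc'
  have hcc : ∀ j, c j ≤ c' j := by
    intro j
    by_cases hj : j = i
    · subst hj
      simp [hc']
    · simp [hc', Function.update_of_ne hj]
  have hc'i : c' i = c i + 1 := by simp [hc']
  have hlt : ∀ x : MVar v n, x ≠ ⟨i, d⟩ → (x.2 : ℕ) < c' x.1 → (x.2 : ℕ) < c x.1 := by
    rintro ⟨j, q⟩ hx h
    by_cases hj : j = i
    · subst hj
      rw [hc'i] at h
      have : (q : ℕ) ≠ c j := fun hq => hx (by rw [hd]; congr; exact Fin.ext hq)
      change (q : ℕ) < c j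
      change (q : ℕ) < c j + 1 at h
      omega
    · rwa [hc', Function.update_of_ne hj] at h
  have hinj : Function.Injective fun w : MVar v n →₀ ℕ => w + Finsupp.single ⟨i, d⟩ 1 :=
    add_left_injective _
  have hsplit : outside M c' (b + Pi.single i 1) =
      (fun w : MVar v n →₀ ℕ => w + Finsupp.single ⟨i, d⟩ 1) '' outside M c' b ∪
        outside M c (b + Pi.single i 1) := by
    ext w
    constructor
    · rintro ⟨hw, hs, hwM⟩
      by_cases h0 : w ⟨i, d⟩ = 0
      · refine Or.inr ⟨hw, fun x hx => hlt x ?_ (hs x hx), hwM⟩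
        rintro rfl
        exact hx h0
      · have hle : Finsupp.single (⟨i, d⟩ : MVar v n) 1 ≤ w := by
          rw [Finsupp.single_le_iff]
          omega
        have heq : w - Finsupp.single ⟨i, d⟩ 1 + Finsupp.single ⟨i, d⟩ 1 = w :=
          tsub_add_cancel_of_le hle
        refine Or.inl ⟨w - Finsupp.single ⟨i, d⟩ 1, ⟨?_, fun x hx => hs x ?_, fun h => ?_⟩, heq⟩
        · rw [← heq, map_add, weight_single] at hw
          exact add_right_cancel hw
        · intro h
          rw [Finsupp.tsub_apply, h, zero_tsub] at hx
          exact hx rfl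
        · exact hwM (hM.upward tsub_le_self h)
    · rintro (⟨w, ⟨hw, hs, hwM⟩, rfl⟩ | ⟨hw, hs, hwM⟩)
      · refine ⟨?_, fun x hx => ?_, fun h => hwM (hN i d w (fun j hj => ?_) ?_ h)⟩
        · rw [map_add, weight_single, hw]
        · by_cases hxd : x = ⟨i, d⟩
          · subst hxd
            rw [hc'i]
            exact Nat.lt_succ_self _
          · refine hs x ?_
            rwa [Finsupp.add_apply, Finsupp.single_eq_of_ne hxd, add_zero] at hx
        · have := hs _ hj
          rw [hc'i] at this
          exact Nat.lt_succ_iff.1 this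
        · rw [hw]
          exact hb
      · exact ⟨hw, fun x hx => (hs x hx).trans_le (hcc _), hwM⟩
  rw [hsplit, Set.ncard_union_eq _ ((outside_finite _ _ _).image _) (outside_finite _ _ _),
    Set.ncard_image_of_injective _ hinj]
  rw [Set.disjoint_left]
  rintro _ ⟨w, -, rfl⟩ ⟨-, hs, -⟩
  have := hs ⟨i, d⟩ (by simp)
  exact lt_irrefl _ this

theorem ncard_outside_full {M : Set (MVar v n →₀ ℕ)} (a c : Fin v → ℕ)
    (hc : ∀ i, n i + 1 ≤ c i) :
    (degPart M a).ncard + (outside M c a).ncard =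
      {w : MVar v n →₀ ℕ | Finsupp.weight (wt v n) w = a}.ncard := by
  rw [← Set.ncard_union_eq _ (degPart_finite M a) (outside_finite M _ a)]
  · congr 1
    ext w
    constructor
    · rintro (h | h)
      · exact h.2
      · exact h.1
    · intro h
      by_cases hw : w ∈ M
      · exact Or.inl ⟨hw, h⟩
      · exact Or.inr ⟨h, fun x _ => x.2.2.trans_le (hc _), hw⟩
  · rw [Set.disjoint_left]
    exact fun w h h' => h'.2.2 h.1

/-- Two Borel sets with the same Hilbert function have, in large degrees, the same number of
exponents outside which only involve prescribed initial segments of the rows. -/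
theorem exists_ncard_outside_eq {M M' : Set (MVar v n →₀ ℕ)} (hM : IsBorelSet M)
    (hM' : IsBorelSet M') (hcount : ∀ a, (degPart M a).ncard = (degPart M' a).ncard)
    (A : Finset (Fin v)) (c : Fin v → ℕ) (hc : ∀ i, i ∉ A → n i + 1 ≤ c i) :
    ∃ N : ℕ, ∀ a : Fin v → ℕ, (∀ i ∈ A, N ≤ a i) →
      (outside M c a).ncard = (outside M' c a).ncard := by
  classical
  obtain ⟨N₁, hN₁⟩ := hM.exists_stable
  obtain ⟨N₂, hN₂⟩ := hM'.exists_stable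
  induction hd : ∑ i, (n i + 1 - c i) using Nat.strong_induction_on generalizing c with
  | _ d ih =>
    by_cases hfull : ∀ i, n i + 1 ≤ c i
    · refine ⟨0, fun a _ => ?_⟩
      have h1 := ncard_outside_full (M := M) a c hfull
      have h2 := ncard_outside_full (M := M') a c hfull
      have h3 := hcount a
      omega
    · push Not at hfull
      obtain ⟨i, hi⟩ := hfull
      have hiA : i ∈ A := by
        by_contra h
        exact absurd (hc i h) (not_le.2 hi)
      have hupd : ∀ j, j ≠ i → Function.update c i (c i + 1) j = c j := fun j hj =>
        Function.update_of_ne hj _ _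
      obtain ⟨N₃, hN₃⟩ := ih (∑ j, (n j + 1 - Function.update c i (c i + 1) j))
        (by
          rw [← hd]
          refine Finset.sum_lt_sum (fun j _ => ?_) ⟨i, Finset.mem_univ _, ?_⟩
          · by_cases hj : j = i
            · subst hj
              rw [Function.update_self]
              omega
            · rw [hupd j hj]
          · rw [Function.update_self]
            omega)
        (Function.update c i (c i + 1))
        (fun j hj => by
          rw [hupd j (fun h => hj (h ▸ hiA))]
          exact hc j hj) rfl
      refine ⟨max N₃ (max N₁ N₂) + 1, fun a ha => ?_⟩
      obtain ⟨b, rfl⟩ : ∃ b : Fin v → ℕ, a = b + Pi.single i 1 := by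
        refine ⟨a - Pi.single i 1, (tsub_add_cancel_of_le ?_).symm⟩
        intro j
        by_cases hj : j = i
        · subst hj
          have h := ha j hiA
          simp only [Pi.single_eq_same]
          omega
        · rw [Pi.single_eq_of_ne hj]
          exact Nat.zero_le _
      have hb : ∀ j ∈ A, max N₃ (max N₁ N₂) ≤ b j := by
        intro j hj
        have := ha j hj
        rw [Pi.add_apply] at this
        by_cases hji : j = i
        · subst hji
          rw [Pi.single_eq_same] at this
          omega
        · rw [Pi.single_eq_of_ne hji] at this
          omega
      have h1 := ncard_outside_succ hM hN₁ c b i hi (by have := hb i hiA; omega)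
      have h2 := ncard_outside_succ hM' hN₂ c b i hi (by have := hb i hiA; omega)
      have h3 := hN₃ b fun j hj => (le_max_left _ _).trans (hb j hj)
      have h4 := hN₃ (b + Pi.single i 1) fun j hj =>
        ((le_max_left _ _).trans (hb j hj)).trans (Nat.le_add_right _ _)
      omega

/-- The first variable occurring in each row. -/
theorem exists_first_index (u : MVar v n →₀ ℕ) :
    ∃ f : ∀ i : Fin v, Fin (n i + 1), (∀ x, u x ≠ 0 → f x.1 ≤ x.2) ∧
      ∀ i, u ⟨i, f i⟩ = 0 → ((f i : ℕ) = n i ∧ Finsupp.weight (wt v n) u i = 0) := by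
  classical
  have h : ∀ i, ∃ d : Fin (n i + 1), (∀ j, u ⟨i, j⟩ ≠ 0 → d ≤ j) ∧
      (u ⟨i, d⟩ = 0 → ((d : ℕ) = n i ∧ Finsupp.weight (wt v n) u i = 0)) := by
    intro i
    by_cases hne : (Finset.univ.filter fun j => u ⟨i, j⟩ ≠ 0).Nonempty
    · obtain ⟨d, hd, hmin⟩ := Finset.exists_min_image _ id hne
      exact ⟨d, fun j hj => hmin j (by simpa using hj),
        fun h0 => absurd h0 (Finset.mem_filter.1 hd).2⟩
    · rw [Finset.not_nonempty_iff_eq_empty, Finset.filter_eq_empty_iff] at hne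
      have hz : ∀ j, u ⟨i, j⟩ = 0 := fun j => not_not.1 (hne (Finset.mem_univ j))
      refine ⟨Fin.last _, fun j hj => absurd (hz j) hj, fun _ => ⟨rfl, ?_⟩⟩
      rw [weight_wt_apply]
      exact Finset.sum_eq_zero fun j _ => hz j
  choose f hf hf' using h
  exact ⟨f, fun x hx => hf x.1 x.2 hx, hf'⟩

theorem IsBorelSet.subset_of_ncard_eq {M M' : Set (MVar v n →₀ ℕ)} (hM : IsBorelSet M)
    (hM' : IsBorelSet M') (hrad : ∀ {m : MVar v n →₀ ℕ} {N : ℕ}, N • m ∈ M' → m ∈ M')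
    (hcount : ∀ a, (degPart M a).ncard = (degPart M' a).ncard) : M ⊆ M' := by
  classical
  intro u hu
  obtain ⟨f, hf, hf'⟩ := exists_first_index u
  set A : Finset (Fin v) := Finset.univ.filter fun i => u ⟨i, f i⟩ ≠ 0 with hA
  have hAmem : ∀ i, i ∈ A ↔ u ⟨i, f i⟩ ≠ 0 := fun i => by simp [hA]
  set c : Fin v → ℕ := fun i => (f i : ℕ) + 1 with hc
  obtain ⟨N, hN⟩ := exists_ncard_outside_eq hM hM' hcount A c fun i hi => by
    rw [hAmem, not_not] at hi
    have := (hf' i hi).1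
    rw [hc]
    dsimp only
    omega
  set e := Finsupp.weight (wt v n) u with he
  set a : Fin v → ℕ := fun i => if i ∈ A then N + (n i + 1) * e i else 0 with ha
  have hempty : outside M c a = ∅ := by
    refine Set.eq_empty_of_forall_notMem ?_
    rintro w ⟨hw, hs, hwM⟩
    refine hwM ?_
    have hk : ∀ i, ∃ k : Fin (n i + 1), (∀ j, u ⟨i, j⟩ ≠ 0 → k ≤ j) ∧ e i ≤ w ⟨i, k⟩ := by
      intro i
      by_cases hi : i ∈ A
      · have hpos : 0 < e i := by
          refine lt_of_lt_of_le (Nat.pos_of_ne_zero ((hAmem i).1 hi)) ?_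
          exact le_weight_wt u ⟨i, f i⟩
        obtain ⟨k, -, hk⟩ := Finset.exists_le_of_sum_le (s := Finset.univ)
          (f := fun _ : Fin (n i + 1) => e i) (g := fun j => w ⟨i, j⟩) Finset.univ_nonempty (by
            rw [← weight_wt_apply, hw, Finset.sum_const, Finset.card_univ, Fintype.card_fin,
              smul_eq_mul, ha]
            dsimp only
            rw [if_pos hi]
            omega)
        refine ⟨k, fun j hj => ?_, hk⟩
        have h1 : (k : ℕ) < f i + 1 := hs ⟨i, k⟩ (by omega)
        have h2 : k ≤ f i := Fin.le_def.2 (Nat.lt_succ_iff.1 h1)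
        exact h2.trans (hf ⟨i, j⟩ hj)
      · rw [hAmem, not_not] at hi
        refine ⟨f i, fun j hj => hf ⟨i, j⟩ hj, ?_⟩
        rw [(hf' i hi).2]
        exact Nat.zero_le _
    choose k hk1 hk2 using hk
    exact hM.upward (mapDomain_collapse_le k u w hk2)
      (hM.mapDomain_collapse_mem k hu fun x hx => hk1 x.1 x.2 hx)
  have hempty' : outside M' c a = ∅ := by
    rw [← Set.ncard_eq_zero (outside_finite _ _ _), ← hN a fun i hi => ?_, hempty,
      Set.ncard_empty]
    rw [ha]
    dsimp only
    rw [if_pos hi]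
    exact Nat.le_add_right _ _
  set w : MVar v n →₀ ℕ :=
    Finsupp.equivFunOnFinite.symm fun x => if x.2 = f x.1 then a x.1 else 0 with hw
  have hwx : ∀ x, w x = if x.2 = f x.1 then a x.1 else 0 := fun x => rfl
  have hwM' : w ∈ M' := by
    by_contra hcon
    have : w ∈ outside M' c a := by
      refine ⟨?_, fun x hx => ?_, hcon⟩
      · funext i
        rw [weight_wt_apply]
        simp [hwx]
      · rw [hwx] at hx
        have h1 : x.2 = f x.1 := by
          by_contra h
          exact hx (if_neg h)
        rw [h1]
        exact Nat.lt_succ_self _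
    rw [hempty'] at this
    exact this
  refine hrad (N := ∑ i, a i) (hM'.upward (fun x => ?_) hwM')
  rw [hwx, Finsupp.smul_apply, smul_eq_mul]
  split_ifs with hx
  · by_cases hxA : x.1 ∈ A
    · have h1 : u x ≠ 0 := by
        have := (hAmem _).1 hxA
        rwa [← hx] at this
      calc a x.1 ≤ ∑ i, a i := Finset.single_le_sum (f := a) (fun _ _ => Nat.zero_le _)
            (Finset.mem_univ _)
        _ ≤ (∑ i, a i) * u x := Nat.le_mul_of_pos_right _ (Nat.pos_of_ne_zero h1)
    · have : a x.1 = 0 := if_neg hxA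
      rw [this]
      exact Nat.zero_le _
  · exact Nat.zero_le _

theorem eq_of_subset_of_ncard_degPart {M M' : Set (MVar v n →₀ ℕ)} (h : M ⊆ M')
    (hcount : ∀ a, (degPart M a).ncard = (degPart M' a).ncard) : M = M' := by
  refine h.antisymm fun m hm => ?_
  have h1 : degPart M (Finsupp.weight (wt v n) m) = degPart M' (Finsupp.weight (wt v n) m) :=
    Set.eq_of_subset_of_ncard_le (fun x hx => ⟨h hx.1, hx.2⟩) (hcount _).ge (degPart_finite _ _)
  have h2 : m ∈ degPart M' (Finsupp.weight (wt v n) m) := ⟨hm, rfl⟩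
  rw [← h1] at h2
  exact h2.1

/-- The generators of a radical Borel set have degree at most one in each row. -/
theorem IsBorelSet.exists_le_weight_le_one {M : Set (MVar v n →₀ ℕ)} (hM : IsBorelSet M)
    (hrad : ∀ {m : MVar v n →₀ ℕ} {N : ℕ}, N • m ∈ M → m ∈ M) {m : MVar v n →₀ ℕ}
    (hm : m ∈ M) : ∃ z ∈ M, z ≤ m ∧ ∀ i, Finsupp.weight (wt v n) z i ≤ 1 := by
  classical
  obtain ⟨f, hf, hf'⟩ := exists_first_index m
  set z : MVar v n →₀ ℕ :=
    Finsupp.equivFunOnFinite.symm fun x => if x.2 = f x.1 ∧ m x ≠ 0 then 1 else 0 with hz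
  have hzx : ∀ x, z x = if x.2 = f x.1 ∧ m x ≠ 0 then 1 else 0 := fun x => rfl
  set e := Finsupp.weight (wt v n) m with he
  refine ⟨z, hrad (N := ∑ i, e i) (hM.upward (mapDomain_collapse_le f m _ fun i => ?_)
    (hM.mapDomain_collapse_mem f hm hf)), fun x => ?_, fun i => ?_⟩
  · by_cases h0 : m ⟨i, f i⟩ = 0
    · change e i ≤ _
      rw [(hf' i h0).2]
      exact Nat.zero_le _
    · rw [Finsupp.smul_apply, hzx, if_pos ⟨rfl, h0⟩, smul_eq_mul, mul_one]
      exact Finset.single_le_sum (f := e) (fun _ _ => Nat.zero_le _) (Finset.mem_univ i)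
  · rw [hzx]
    split_ifs with h
    · exact Nat.one_le_iff_ne_zero.2 h.2
    · exact Nat.zero_le _
  · rw [weight_wt_apply]
    calc ∑ j, z ⟨i, j⟩ ≤ ∑ j, if j = f i then 1 else 0 := by
          refine Finset.sum_le_sum fun j _ => ?_
          rw [hzx]
          split_ifs with h1 h2
          · exact le_rfl
          · exact absurd h1.1 h2
          · exact Nat.zero_le _
          · exact le_rfl
      _ = 1 := by simp

end BorelSets

section Conclusion

variable {K : Type} [Field K] {v : ℕ} {n : Fin v → ℕ}

theorem exists_respectsVarOrder (v : ℕ) (n : Fin v → ℕ) :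
    ∃ τ : MonomialOrder.{0, 0} (MVar v n), RespectsVarOrder τ := by
  let ord : LinearOrder (MVar v n) :=
    LinearOrder.lift' (fun x => (toLex x : Σₗ i : Fin v, Fin (n i + 1))) toLex.injective
  have hwf : @WellFoundedGT (MVar v n) ord.toLT :=
    @Finite.to_wellFoundedGT (MVar v n) _ ord.toPreorder
  refine ⟨@MonomialOrder.lex (MVar v n) ord hwf, fun i j k hjk => ?_⟩
  refine (@Finsupp.Lex.single_lt_iff (MVar v n) ord _ _).2 ?_
  exact Sigma.Lex.lt_def.2 (Or.inr ⟨rfl, hjk⟩)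

theorem BorelFixed.isBorelSet [Infinite K] {J : Ideal (MvPolynomial (MVar v n) K)}
    (hJ : BorelFixed J) : IsBorelSet (expSet J) where
  upward := expSet_upward
  move i _ _ hkc _ hm := hJ.mapDomain_rowMove_mem i hkc hm

variable (τ : MonomialOrder (MVar v n))

theorem genLead_eq_expSet [Infinite K] (hτ : RespectsVarOrder τ)
    {I J : Ideal (MvPolynomial (MVar v n) K)} (hI : IsMultigraded I)
    (hJrad : J.IsRadical) (hJ : BorelFixed J) (hHS : sameHS I J)
    {U : Ultrafilter (Mats K v n)} (hU : (U : Filter (Mats K v n)) ≤ genericFilter K v n) :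
    genLead τ U I = expSet J := by
  have hM : IsBorelSet (genLead τ U I) :=
    { upward := genLead_upward τ hU I
      move := fun i _ _ hkc _ hm => mapDomain_rowMove_mem_genLead τ hτ hU hI i hkc hm }
  have hcount : ∀ a, (degPart (genLead τ U I) a).ncard = (degPart (expSet J) a).ncard :=
    fun a => by rw [ncard_degPart_genLead τ hU hI, hJ.ncard_degPart_expSet τ, hHS]
  exact eq_of_subset_of_ncard_degPart
    (hM.subset_of_ncard_eq hJ.isBorelSet (mem_expSet_of_nsmul_mem hJrad) hcount) hcount

theorem eventually_leadSet_eq_expSet [Infinite K] (hτ : RespectsVarOrder τ)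
    {I J : Ideal (MvPolynomial (MVar v n) K)} (hI : IsMultigraded I)
    (hJrad : J.IsRadical) (hJ : BorelFixed J) (hHS : sameHS I J) :
    ∀ᶠ g in genericFilter K v n, leadSet τ (gMap g (I.restrictScalars K)) = expSet J := by
  have hfin : {z ∈ expSet J | ∀ i, Finsupp.weight (wt v n) z i ≤ 1}.Finite := by
    refine (Set.finite_Icc 0 (Finsupp.equivFunOnFinite.symm fun _ : MVar v n => 1)).subset ?_
    exact fun z hz => ⟨zero_le, fun x => (le_weight_wt z x).trans (hz.2 x.1)⟩
  have hgen : ∀ᶠ g in genericFilter K v n,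
      ∀ z ∈ {z ∈ expSet J | ∀ i, Finsupp.weight (wt v n) z i ≤ 1},
        z ∈ leadSet τ (gMap g (I.restrictScalars K)) := by
    rw [Set.Finite.eventually_all hfin]
    intro z hz
    refine Filter.mem_iff_ultrafilter.2 fun U hU => ?_
    have := hz.1
    rwa [← genLead_eq_expSet τ hτ hI hJrad hJ hHS hU] at this
  filter_upwards [hgen, eventually_isUnit_det] with g hg hdet
  refine (eq_of_subset_of_ncard_degPart (fun m hm => ?_) fun a => ?_).symm
  · obtain ⟨z, hz, hzm, hz1⟩ :=
      hJ.isBorelSet.exists_le_weight_le_one (mem_expSet_of_nsmul_mem hJrad) hm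
    exact leadSet_gMap_upward τ hdet I hzm (hg z ⟨hz, hz1⟩)
  · rw [hJ.ncard_degPart_expSet τ, ← leadSet_gMap_hpart_eq_degPart τ g hI,
      ncard_leadSet_gMap_hpart τ hdet, hHS]

variable {τ}

theorem le_of_leadSet_gMap_subset {g : Mats K v n} (hg : ∀ i, IsUnit (g i).det)
    {P Q : Ideal (MvPolynomial (MVar v n) K)} (hPQ : P ≤ Q)
    (h : leadSet τ (gMap g (Q.restrictScalars K)) ⊆ leadSet τ (gMap g (P.restrictScalars K))) :
    Q ≤ P := by
  intro f hf
  obtain ⟨p, hp, hpf⟩ := le_of_leadSet_subset τ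
    (show gMap g (P.restrictScalars K) ≤ gMap g (Q.restrictScalars K) from
      Submodule.map_mono hPQ) h ⟨f, hf, rfl⟩
  exact (gAct_bijective g hg).1 hpf ▸ hp

theorem isRadical_of_leadSet_eq {g : Mats K v n} (hg : ∀ i, IsUnit (g i).det)
    {I J : Ideal (MvPolynomial (MVar v n) K)} (hJ : J.IsRadical)
    (h : leadSet τ (gMap g (I.restrictScalars K)) = expSet J) : I.IsRadical := by
  refine le_of_leadSet_gMap_subset (τ := τ) hg I.le_radical ?_
  rintro _ ⟨_, ⟨p, ⟨k, hk⟩, rfl⟩, hp0, rfl⟩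
  rw [h]
  refine mem_expSet_of_nsmul_mem hJ (N := k) ?_
  rw [← h, ← τ.degree_pow]
  exact ⟨_, ⟨p ^ k, hk, map_pow (gAct g) p k⟩, pow_ne_zero k hp0, rfl⟩

theorem eq_span_of_leadSet_eq {g : Mats K v n} (hg : ∀ i, IsUnit (g i).det)
    {I : Ideal (MvPolynomial (MVar v n) K)} (hI : IsMultigraded I)
    (h : ∀ m ∈ leadSet τ (gMap g (I.restrictScalars K)),
      ∃ z ∈ leadSet τ (gMap g (I.restrictScalars K)), z ≤ m ∧
        ∀ i, Finsupp.weight (wt v n) z i ≤ 1) :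
    I = Ideal.span {f ∈ I | ∃ a : Fin v → ℕ, (∀ i, a i ≤ 1) ∧
      f.IsWeightedHomogeneous (wt v n) a} := by
  refine le_antisymm ?_ (Ideal.span_le.2 fun f hf => hf.1)
  refine le_of_leadSet_gMap_subset (τ := τ) hg (Ideal.span_le.2 fun f hf => hf.1) fun m hm => ?_
  obtain ⟨z, hz, hzm, hz1⟩ := h m hm
  refine leadSet_gMap_upward τ hg _ hzm ?_
  refine leadSet_mono τ (Submodule.map_mono fun f hf => ?_) ((mem_leadSet_gMap_iff τ g hI z).1 hz)
  exact Ideal.subset_span ⟨hf.1, _, hz1, hf.2⟩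

end Conclusion

end CSPaper

/-- If `I` is a Cartwright-Sturmfels ideal and `J` is a radical Borel fixed ideal with the
same `ℤ^v`-graded Hilbert series as `I`, then `gin_τ(I) = J` for every term order `τ`
(with `x_{i j} > x_{i k}` for `j < k`); in particular `I` is radical and is generated by
multihomogeneous elements of multidegree at most `e_1 + ⋯ + e_v = (1,…,1)`. -/
theorem CS_gin_eq_radical_borel
    {K : Type} [Field K] [Infinite K] {v : ℕ} {n : Fin v → ℕ}
    (I J : Ideal (MvPolynomial (MVar v n) K)) (hI : IsMultigraded I)
    (hJrad : J.IsRadical) (hJborel : BorelFixed J) (hHS : sameHS I J) :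
    (∀ τ : MonomialOrder (MVar v n), RespectsVarOrder τ → IsGin τ I J) ∧
    I.IsRadical ∧
    ∃ G : Set (MvPolynomial (MVar v n) K),
      (∀ f ∈ G, ∃ a : Fin v → ℕ, (∀ i, a i ≤ 1) ∧
        f.IsWeightedHomogeneous (wt v n) a) ∧
      I = Ideal.span G := by
  obtain ⟨τ, hτ⟩ := exists_respectsVarOrder v n
  obtain ⟨g, h, hg⟩ := ((eventually_leadSet_eq_expSet τ hτ hI hJrad hJborel hHS).and
    eventually_isUnit_det).exists
  refine ⟨fun τ hτ => ?_, isRadical_of_leadSet_eq hg hJrad h, _, fun f hf => hf.2,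
    eq_span_of_leadSet_eq (τ := τ) hg hI ?_⟩
  · change ∀ᶠ g in genericFilter K v n, _
    filter_upwards [eventually_leadSet_eq_expSet τ hτ hI hJrad hJborel hHS,
      eventually_isUnit_det] with g h hg
    exact hJborel.inIdeal_map_eq τ hg h
  · rw [h]
    exact fun m hm =>
      hJborel.isBorelSet.exists_le_weight_le_one (mem_expSet_of_nsmul_mem hJrad) hm

end
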